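/- arXiv:1906.12054 — 13 statements merged into one kernel-verified Lean document; each statement's English description precedes it below -/
import Mathlib

section
/- Let F_q be a finite field of odd order q, let λ ∈ F_q be a non-square element, and let f ∈ F_q[X] be a permutation polynomial of F_q. In the equational graph G(λ,f), every vertex lies on a directed cycle and every edge lies on a directed cycle; in particular, every weakly connected component of G(λ,f) is strongly connected. -/
open Polynomial

/-- Edge relation of the equational graph `G(l, f)` over a field:
there is an edge from `x` to `y` iff `(y² - f(x))·(l·y² - f(x)) = 0`. -/
def EqEdge {F : Type*} [Field F] (l : F) (f : Polynomial F) (x y : F) : Prop :=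
  (y ^ 2 - f.eval x) * (l * y ^ 2 - f.eval x) = 0

/-- Weak reachability: reachability in the underlying undirected graph. -/
def WeakReach {V : Type*} (E : V → V → Prop) : V → V → Prop :=
  Relation.ReflTransGen fun u v => E u v ∨ E v u

/-- The weakly connected component of a vertex. -/
def WeakComp {V : Type*} (E : V → V → Prop) (x : V) : Set V :=
  {y | WeakReach E x y}

/-- A directed cycle of length `n ≥ 1`, visiting `n` distinct vertices. -/
def IsCycle {V : Type*} (E : V → V → Prop) (n : ℕ) (v : ZMod n → V) : Prop :=
  0 < n ∧ Function.Injective v ∧ ∀ i, E (v i) (v (i + 1))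

/-- A directed path with `m` edges and `m + 1` distinct vertices `v 0, v 1, ..., v m`. -/
def IsPathOn {V : Type*} (E : V → V → Prop) (m : ℕ) (v : ℕ → V) : Prop :=
  (∀ i < m, E (v i) (v (i + 1))) ∧ ∀ i ≤ m, ∀ j ≤ m, v i = v j → i = j

open Classical in
/-- The weight of the edge `(x, y)` in `G(l, f)`: `0` if `y² = f(x)`, and `1` otherwise. -/
noncomputable def wt {F : Type*} [Field F] (l : F) (f : Polynomial F) (x y : F) : ℕ :=
  if y ^ 2 = f.eval x then 0 else 1

/-- A sequence `w` of `m` edge weights contains a trail of length `n`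
(`n` consecutive edges of the same weight). -/
def ContainsTrail (w : ℕ → ℕ) (m n : ℕ) : Prop :=
  ∃ i, i + n ≤ m ∧ ∀ k < n, w (i + k) = w i

/-- A path with `m` edges whose weights are given by `w` is of Type `n`:
it contains a trail of length `n` but none of greater length. -/
def PathTypeN (w : ℕ → ℕ) (m n : ℕ) : Prop :=
  ContainsTrail w m n ∧ ∀ k, n < k → ¬ ContainsTrail w m k

/-- `c` is a Hamiltonian cycle of the (connected) equational graph `G(l, f)` which is of
Type `n`, i.e. removing the vertex `0` from the cycle leaves a path of Type `n`. -/
def IsHamCycleOfType {F : Type*} [Field F] [Fintype F] (l : F) (f : Polynomial F)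
    (c : ZMod (Fintype.card F) → F) (n : ℕ) : Prop :=
  Function.Bijective c ∧ (∀ i, EqEdge l f (c i) (c (i + 1))) ∧
  ∃ i0 : ZMod (Fintype.card F), c i0 = 0 ∧
    PathTypeN (fun k => wt l f (c (i0 + 1 + (k : ZMod (Fintype.card F))))
      (c (i0 + 1 + (k : ZMod (Fintype.card F)) + 1))) (Fintype.card F - 2) n

open Classical in
/-- The quadratic character of a field: `1` on non-zero squares, `-1` on non-squares,
and `qchar 0 = 0`. -/
noncomputable def qchar {F : Type*} [Field F] (u : F) : ℤ :=
  if u = 0 then 0 else if ∃ z : F, z ^ 2 = u then 1 else -1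

/-- A permutation `r` all of whose arrows are edges gives a directed cycle through any of
its arrows. -/
theorem exists_isCycle_of_perm {V : Type*} [Finite V] {E : V → V → Prop} (r : Equiv.Perm V)
    (hr : ∀ x, E x (r x)) (x : V) :
    ∃ (n : ℕ) (v : ZMod n → V) (i : ZMod n), IsCycle E n v ∧ v i = x ∧ v (i + 1) = r x := by
  have hpos : 0 < Function.minimalPeriod r x :=
    Function.minimalPeriod_pos_of_mem_periodicPts
      (r.injective.mem_periodicPts x)
  set n := Function.minimalPeriod r x with hn
  have : NeZero n := ⟨hpos.ne'⟩
  have hsucc (i : ZMod n) : r^[(i + 1).val] x = r (r^[i.val] x) := by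
    rw [← Function.iterate_succ_apply' r, ZMod.val_add, ZMod.val_one_eq_one_mod, Nat.add_mod_mod]
    exact Function.iterate_mod_minimalPeriod_eq
  refine ⟨n, fun i => r^[i.val] x, 0, ⟨hpos, fun i j hij => ?_, fun i => ?_⟩, by simp, ?_⟩
  · exact ZMod.val_injective n
      (Function.iterate_injOn_Iio_minimalPeriod (ZMod.val_lt i) (ZMod.val_lt j) hij)
  · simp only [hsucc]
    exact hr _
  · simpa only [ZMod.val_zero, Function.iterate_zero_apply] using hsucc 0

theorem IsCycle.reflTransGen_succ {V : Type*} {E : V → V → Prop} {n : ℕ} {v : ZMod n → V}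
    (h : IsCycle E n v) (i : ZMod n) : Relation.ReflTransGen E (v (i + 1)) (v i) := by
  have : NeZero n := ⟨h.1.ne'⟩
  have key (k : ℕ) : Relation.ReflTransGen E (v (i + 1)) (v (i + 1 + k)) := by
    induction k with
    | zero => simpa using Relation.ReflTransGen.refl
    | succ k ih =>
      have := ih.tail (h.2.2 _)
      rwa [Nat.cast_succ, ← add_assoc]
  simpa using key (-1 : ZMod n).val

/-- In a finite type of odd characteristic, one can pick one element of each pair `{z, -z}`. -/
theorem exists_neg_iff_not {F : Type*} [Field F] [Fintype F] (h2 : (2 : F) ≠ 0) :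
    ∃ P : F → Prop, ∀ z, z ≠ 0 → (P (-z) ↔ ¬ P z) := by
  let e := Fintype.equivFin F
  refine ⟨fun z => e z < e (-z), fun z hz => ?_⟩
  have hne : e z ≠ e (-z) := fun h => by
    have h' := e.injective h
    have : 2 * z = 0 := by linear_combination h'
    exact (mul_ne_zero h2 hz) this
  beta_reduce
  rw [neg_neg, not_lt]
  exact ⟨le_of_lt, fun h => lt_of_le_of_ne h hne.symm⟩

/-- Every edge of `G(l, f)` is an arrow of a permutation all of whose arrows are edges. -/
theorem EqEdge.exists_perm {F : Type*} [Field F] [Fintype F] (h2 : (2 : F) ≠ 0)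
    {l : F} (hl : ∀ z : F, z ^ 2 ≠ l)
    {f : Polynomial F} (hf : Function.Bijective fun x => f.eval x) {x y : F}
    (hxy : EqEdge l f x y) :
    ∃ r : Equiv.Perm F, (∀ z, EqEdge l f z (r z)) ∧ r x = y := by
  classical
  obtain ⟨P, hP⟩ := exists_neg_iff_not h2
  obtain ⟨Q, hQ, hQy⟩ : ∃ Q : F → Prop, (∀ z, z ≠ 0 → (Q (-z) ↔ ¬ Q z)) ∧
      (Q y ↔ y ^ 2 = f.eval x) :=
    ⟨fun z => (P z ↔ P y) ↔ y ^ 2 = f.eval x, fun z hz => by have := hP z hz; tauto, by simp⟩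
  have hsq (a b : F) (h : a ^ 2 = l * b ^ 2) : a = 0 ∧ b = 0 := by
    by_cases hb : b = 0
    · subst hb
      simpa using h
    · refine absurd ?_ (hl (a / b))
      field_simp
      linear_combination h
  let g : F → F := fun z => if Q z then z ^ 2 else l * z ^ 2
  have hg : Function.Injective g := by
    intro a b hab
    have hl0 : l ≠ 0 := fun h => hl 0 (by simp [h])
    have hneg (hQab : Q a ↔ Q b) (h : a ^ 2 = b ^ 2) : a = b := by
      rcases sq_eq_sq_iff_eq_or_eq_neg.1 h with h | rfl
      · exact h
      · by_cases hb : b = 0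
        · simp [hb]
        · have := hQ b hb
          tauto
    by_cases ha : Q a <;> by_cases hb : Q b <;> simp only [g, ha, hb, if_true, if_false] at hab
    · exact hneg (by tauto) hab
    · obtain ⟨rfl, rfl⟩ := hsq _ _ hab
      rfl
    · obtain ⟨rfl, rfl⟩ := hsq _ _ hab.symm
      rfl
    · exact hneg (by tauto) (mul_left_cancel₀ hl0 hab)
  let G : Equiv.Perm F := Equiv.ofBijective g (Finite.injective_iff_bijective.1 hg)
  let r : Equiv.Perm F := (Equiv.ofBijective _ hf).trans G.symm
  have hr (z : F) : g (r z) = f.eval z := G.apply_symm_apply _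
  refine ⟨r, fun z => ?_, hg ?_⟩
  · have := hr z
    unfold EqEdge
    by_cases h : Q (r z) <;> simp only [g, h, if_true, if_false] at this <;> simp [this]
  · rw [hr]
    rcases mul_eq_zero.1 hxy with h | h
    · have h' := sub_eq_zero.1 h
      simp [g, hQy.2 h', h']
    · have h' := sub_eq_zero.1 h
      by_cases hy : Q y
      · simp [g, hy, hQy.1 hy]
      · simp [g, hy, h']

/-- every vertex and every edge of `G(l, f)` lies on a directed cycle;
in particular every weakly connected component is strongly connected. -/
theorem stmt1 {F : Type*} [Field F] [Fintype F]
    (hodd : Odd (Fintype.card F))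
    (l : F) (hl : ∀ z : F, z ^ 2 ≠ l)
    (f : Polynomial F) (hf : Function.Bijective fun x => f.eval x) :
    (∀ x : F, ∃ (n : ℕ) (v : ZMod n → F),
      IsCycle (EqEdge l f) n v ∧ ∃ i : ZMod n, v i = x) ∧
    (∀ x y : F, EqEdge l f x y →
      ∃ (n : ℕ) (v : ZMod n → F) (i : ZMod n),
        IsCycle (EqEdge l f) n v ∧ v i = x ∧ v (i + 1) = y) ∧
    (∀ u v : F, WeakReach (EqEdge l f) u v →
      Relation.ReflTransGen (EqEdge l f) u v) := by
  have h2 : (2 : F) ≠ 0 := Ring.two_ne_zero fun h =>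
    (Nat.not_even_iff_odd.2 hodd) (FiniteField.even_card_iff_char_two.1 h |> Nat.even_iff.2)
  have edge : ∀ x y : F, EqEdge l f x y →
      ∃ (n : ℕ) (v : ZMod n → F) (i : ZMod n),
        IsCycle (EqEdge l f) n v ∧ v i = x ∧ v (i + 1) = y := fun x y hxy => by
    obtain ⟨r, hr, rfl⟩ := hxy.exists_perm h2 hl hf
    exact exists_isCycle_of_perm r hr x
  refine ⟨fun x => ?_, edge, fun u v huv => ?_⟩
  · obtain ⟨z, hz⟩ := hf.surjective (x ^ 2)
    obtain ⟨n, v, i, hv, -, hi⟩ := edge z x (by simp_all [EqEdge])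
    exact ⟨n, v, hv, i + 1, hi⟩
  · induction huv with
    | refl => exact .refl
    | tail _ h ih =>
      refine ih.trans ?_
      rcases h with h | h
      · exact .single h
      · obtain ⟨n, v, i, hv, rfl, rfl⟩ := edge _ _ h
        exact hv.reflTransGen_succ i
end

section
/- Let F_q be a finite field of odd order q, let λ ∈ F_q be a non-square element, and let f ∈ F_q[X] be a permutation polynomial of F_q. Then the equational graph G(λ,f) is not a bipartite graph; that is, there is no partition of F_q into two sets S₁ and S₂ such that every directed edge of G(λ,f) goes between the two sets (no edge has both endpoints in S₁ or both in S₂). -/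
open Polynomial

/-- In a finite field every element is `u ^ 2` or `l * u ^ 2`, when `l` is a non-square. -/
lemma exists_sq_or_mul_sq {F : Type*} [Field F] [Fintype F]
    {l : F} (hl : ∀ z : F, z ^ 2 ≠ l) (a : F) :
    ∃ u : F, u ^ 2 = a ∨ l * u ^ 2 = a := by
  classical
  by_cases ha : IsSquare a
  · obtain ⟨u, rfl⟩ := ha
    exact ⟨u, Or.inl (sq u)⟩
  · have hl' : ¬ IsSquare l := fun ⟨z, hz⟩ => hl z (by rw [hz, sq])
    have hl0 : l ≠ 0 := fun h => hl' (h ▸ IsSquare.zero)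
    have ha0 : a ≠ 0 := fun h => ha (h ▸ IsSquare.zero)
    have hprod : quadraticChar F (l * a) = 1 := by
      rw [map_mul, (quadraticChar_neg_one_iff_not_isSquare).2 hl',
        (quadraticChar_neg_one_iff_not_isSquare).2 ha]
      norm_num
    obtain ⟨z, hz⟩ := (quadraticChar_one_iff_isSquare (mul_ne_zero hl0 ha0)).1 hprod
    refine ⟨z / l, Or.inr ?_⟩
    field_simp
    linear_combination -hz

/-- The out-neighbours of a vertex that is not a root of `f` are `u` and `-u`
for some `u ≠ 0`. -/
lemma exists_eqEdge_iff {F : Type*} [Field F] [Fintype F]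
    {l : F} (hl : ∀ z : F, z ^ 2 ≠ l) (f : Polynomial F) {x : F} (hx : f.eval x ≠ 0) :
    ∃ u : F, u ≠ 0 ∧ ∀ y, EqEdge l f x y ↔ y = u ∨ y = -u := by
  have hl0 : l ≠ 0 := fun h => hl 0 (by rw [h]; ring)
  have hne : ∀ v w : F, v ^ 2 = f.eval x → l * w ^ 2 ≠ f.eval x := by
    intro v w hv hw
    have hw0 : w ≠ 0 := by
      rintro rfl
      exact hx (by rw [← hw]; ring)
    apply hl (v / w)
    field_simp
    linear_combination hv - hw
  obtain ⟨u, hu⟩ := exists_sq_or_mul_sq hl (f.eval x)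
  have hu0 : u ≠ 0 := by
    rintro rfl
    rcases hu with hu | hu <;> exact hx (by rw [← hu]; ring)
  refine ⟨u, hu0, fun y => ?_⟩
  rw [EqEdge, mul_eq_zero, sub_eq_zero, sub_eq_zero, ← sq_eq_sq_iff_eq_or_eq_neg]
  rcases hu with hu | hu
  · have h := hne u y hu
    rw [← hu] at h ⊢
    tauto
  · have h : y ^ 2 ≠ f.eval x := fun hy => hne y u hy hu
    rw [← hu] at h ⊢
    rw [mul_right_inj' hl0]
    tauto

open Classical in
/-- A vertex that is not a root of `f` has out-degree two. -/
lemma card_filter_eqEdge_left {F : Type*} [Field F] [Fintype F] (h2 : ringChar F ≠ 2)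
    {l : F} (hl : ∀ z : F, z ^ 2 ≠ l) (f : Polynomial F) {x : F} (hx : f.eval x ≠ 0) :
    (Finset.univ.filter fun y => EqEdge l f x y).card = 2 := by
  obtain ⟨u, hu0, hu⟩ := exists_eqEdge_iff hl f hx
  refine Finset.card_eq_two.2 ⟨u, -u, ?_, by ext y; simp [hu]⟩
  exact fun h => hu0 ((Ring.eq_self_iff_eq_zero_of_char_ne_two h2).1 h.symm)

open Classical in
/-- If `f` permutes the field, every non-zero vertex has in-degree two. -/
lemma card_filter_eqEdge_right {F : Type*} [Field F] [Fintype F]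
    {l : F} (hl : ∀ z : F, z ^ 2 ≠ l) {f : Polynomial F}
    (hf : Function.Bijective fun x => f.eval x) {y : F} (hy : y ≠ 0) :
    (Finset.univ.filter fun x => EqEdge l f x y).card = 2 := by
  obtain ⟨v, hv⟩ := hf.2 (y ^ 2)
  obtain ⟨w, hw⟩ := hf.2 (l * y ^ 2)
  simp only at hv hw
  refine Finset.card_eq_two.2 ⟨v, w, ?_, ?_⟩
  · rintro rfl
    have h : l * y ^ 2 = 1 * y ^ 2 := by rw [← hw, hv, one_mul]
    exact hl 1 (by rw [mul_right_cancel₀ (pow_ne_zero 2 hy) h, one_pow])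
  · ext x
    simp only [Finset.mem_filter, Finset.mem_univ, true_and, Finset.mem_insert,
      Finset.mem_singleton]
    rw [EqEdge, mul_eq_zero, sub_eq_zero, sub_eq_zero, ← hw, ← hv]
    exact or_congr (hf.1.eq_iff.trans eq_comm) (hf.1.eq_iff.trans eq_comm)

/-- If `f` permutes the field, no set containing `0` is such that every edge of `G(l, f)`
joins it to its complement. -/
lemma not_eqEdge_cut {F : Type*} [Field F] [Fintype F] (hodd : Odd (Fintype.card F))
    {l : F} (hl : ∀ z : F, z ^ 2 ≠ l) {f : Polynomial F}
    (hf : Function.Bijective fun x => f.eval x) {S : Set F} (h0 : (0 : F) ∈ S) :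
    ¬ ∀ x y : F, EqEdge l f x y → (x ∈ S ↔ y ∉ S) := by
  classical
  intro h
  have h2 : ringChar F ≠ 2 := fun h' =>
    (Nat.not_even_iff_odd.2 hodd) (FiniteField.even_card_iff_char_two.1 h' |> Nat.even_iff.2)
  have hcard := Finset.card_mul_eq_card_mul (EqEdge l f)
    (s := Finset.univ.filter (· ∈ S)) (t := Finset.univ.filter (· ∉ S)) (m := 2) (n := 2)
    (by
      intro x hx
      have hxS : x ∈ S := by simpa using hx
      have hx0 : f.eval x ≠ 0 := fun hx0 => (h x 0 (by simp [EqEdge, hx0])).1 hxS h0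
      rw [← card_filter_eqEdge_left h2 hl f hx0]
      congr 1
      ext y
      have := h x y
      simp only [Finset.bipartiteAbove, Finset.mem_filter, Finset.mem_univ, true_and]
      tauto)
    (by
      intro y hy
      have hyS : y ∉ S := by simpa using hy
      have hy0 : y ≠ 0 := fun hy0 => hyS (hy0 ▸ h0)
      rw [← card_filter_eqEdge_right hl hf hy0]
      congr 1
      ext x
      have := h x y
      simp only [Finset.bipartiteBelow, Finset.mem_filter, Finset.mem_univ, true_and]
      tauto)
  have hsum := Finset.card_filter_add_card_filter_not (s := (Finset.univ : Finset F)) (· ∈ S)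
  rw [Finset.card_univ] at hsum
  obtain ⟨k, hk⟩ := hodd
  omega

/-- `G(l, f)` with `f` a permutation polynomial is not bipartite. -/
theorem stmt2 {F : Type*} [Field F] [Fintype F]
    (hodd : Odd (Fintype.card F))
    (l : F) (hl : ∀ z : F, z ^ 2 ≠ l)
    (f : Polynomial F) (hf : Function.Bijective fun x => f.eval x) :
    ¬ ∃ S1 S2 : Set F, S1 ∪ S2 = Set.univ ∧ S1 ∩ S2 = ∅ ∧
      ∀ x y : F, EqEdge l f x y →
        ¬(x ∈ S1 ∧ y ∈ S1) ∧ ¬(x ∈ S2 ∧ y ∈ S2) := by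
  rintro ⟨S1, S2, hU, hI, h⟩
  have hcompl : ∀ x, x ∈ S2 ↔ x ∉ S1 := by
    intro x
    have hx : x ∈ S1 ∪ S2 := hU ▸ Set.mem_univ x
    have hx' : x ∉ S1 ∩ S2 := hI ▸ Set.notMem_empty x
    simp only [Set.mem_union, Set.mem_inter_iff] at hx hx'
    tauto
  have hcut : ∀ x y : F, EqEdge l f x y → (x ∈ S1 ↔ y ∉ S1) := by
    intro x y hxy
    have := h x y hxy
    rw [hcompl, hcompl] at this
    tauto
  by_cases h0 : (0 : F) ∈ S1
  · exact not_eqEdge_cut hodd hl hf h0 hcut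
  · refine not_eqEdge_cut hodd hl hf ((hcompl 0).2 h0) fun x y hxy => ?_
    have := hcut x y hxy
    rw [hcompl, hcompl]
    tauto
end

section
/- Let F_q be a finite field of odd order q, let λ ∈ F_q be a non-square element, and let f ∈ F_q[X] be a permutation polynomial of F_q. Then every weakly connected component of the equational graph G(λ,f) has a Hamiltonian cycle, i.e., a directed cycle passing through every vertex of the component exactly once. -/
open Polynomial

open Equiv.Perm in
/-- Composing with the swap of two points in different cycles merges their cycles. -/
theorem sameCycle_mul_swap_of_not_sameCycle {V : Type*} [Finite V] [DecidableEq V]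
    {σ : Equiv.Perm V} {a c : V} (hac : ¬ SameCycle σ a c) :
    SameCycle (σ * Equiv.swap a c) a c ∧
      ∀ y, SameCycle σ a y → SameCycle (σ * Equiv.swap a c) a y := by
  set τ := σ * Equiv.swap a c with hτ
  have hc : SameCycle τ c (σ a) := ⟨1, by simp [hτ]⟩
  have hpow : ∀ k : ℕ, SameCycle τ c ((σ ^ (k + 1)) a) := by
    intro k
    induction k with
    | zero => simpa using hc
    | succ k ih =>
      rw [pow_succ', mul_apply]
      set y := (σ ^ (k + 1)) a with hy
      by_cases hya : y = a
      · rwa [hya]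
      · have hyc : y ≠ c := fun h => hac ⟨(k + 1 : ℕ), by rw [zpow_natCast, ← hy, h]⟩
        have hτy : τ y = σ y := by
          rw [hτ, mul_apply, Equiv.swap_apply_of_ne_of_ne hya hyc]
        exact hτy ▸ sameCycle_apply_right.2 ih
  have hall : ∀ y, SameCycle σ a y → SameCycle τ c y := by
    intro y h
    obtain ⟨i, hi, -, rfl⟩ := h.exists_pow_eq''
    obtain ⟨k, rfl⟩ := Nat.exists_eq_succ_of_ne_zero hi.ne'
    exact hpow k
  have hca := hall a (SameCycle.refl _ _)
  exact ⟨hca.symm, fun y h => hca.symm.trans (hall y h)⟩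

/-- A cycle of a permutation supported on the edges of a digraph is a directed cycle. -/
theorem exists_isCycle_range_eq_sameCycle {V : Type*} [Finite V] {E : V → V → Prop}
    {σ : Equiv.Perm V} (hσ : ∀ x, E x (σ x)) (x : V) :
    ∃ (n : ℕ) (v : ZMod n → V), IsCycle E n v ∧ Set.range v = {y | σ.SameCycle x y} := by
  have hpos : 0 < Function.minimalPeriod σ x :=
    Function.minimalPeriod_pos_of_mem_periodicPts
      (σ.injective.mem_periodicPts x)
  have : NeZero (Function.minimalPeriod σ x) := ⟨hpos.ne'⟩
  refine ⟨Function.minimalPeriod σ x, fun i => σ^[i.val] x, ⟨hpos, ?_, ?_⟩, ?_⟩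
  · intro i j hij
    exact ZMod.val_injective _ (Function.iterate_injOn_Iio_minimalPeriod
      (ZMod.val_lt i) (ZMod.val_lt j) hij)
  · intro i
    have h : σ^[(i + 1).val] x = σ (σ^[i.val] x) := by
      rw [ZMod.val_add, ZMod.val_one_eq_one_mod, Nat.add_mod_mod,
        Function.iterate_mod_minimalPeriod_eq, Function.iterate_succ_apply']
    simpa only [h] using hσ (σ^[i.val] x)
  · ext y
    constructor
    · rintro ⟨i, rfl⟩
      exact ⟨(i.val : ℕ), by rw [zpow_natCast, Equiv.Perm.coe_pow]⟩
    · rintro h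
      obtain ⟨k, -, -, rfl⟩ := h.exists_pow_eq''
      refine ⟨(k : ZMod _), ?_⟩
      simp only [ZMod.val_natCast, Function.iterate_mod_minimalPeriod_eq, Equiv.Perm.coe_pow]

/-- If any two out-neighbourhoods of a finite digraph are equal or disjoint and the digraph has
a spanning permutation, then every weakly connected component has a Hamiltonian cycle. -/
theorem exists_hamiltonian_cycle_weakComp {V : Type*} [Finite V] {E : V → V → Prop}
    (hE : ∀ a b c d, E a c → E b c → E a d → E b d)
    (hperm : ∃ σ : Equiv.Perm V, ∀ x, E x (σ x)) (x : V) :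
    ∃ (n : ℕ) (v : ZMod n → V), IsCycle E n v ∧ Set.range v = WeakComp E x := by
  classical
  have : Nonempty {σ : Equiv.Perm V // ∀ x, E x (σ x)} := hperm.elim fun σ h => ⟨⟨σ, h⟩⟩
  obtain ⟨⟨σ, hσ⟩, hmax⟩ := Finite.exists_max
    fun σ : {σ : Equiv.Perm V // ∀ x, E x (σ x)} => {y | σ.1.SameCycle x y}.ncard
  obtain ⟨n, v, hv, hrange⟩ := exists_isCycle_range_eq_sameCycle hσ x
  refine ⟨n, v, hv, hrange.trans ?_⟩
  have hswap : ∀ a c, σ.SameCycle x a → E a (σ c) → E c (σ a) → σ.SameCycle x c := by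
    intro a c ha hac hca
    by_contra hc
    have hnot : ¬ σ.SameCycle a c := fun h => hc (ha.trans h)
    obtain ⟨h₁, h₂⟩ := sameCycle_mul_swap_of_not_sameCycle hnot
    have hτ : ∀ y, E y ((σ * Equiv.swap a c) y) := by
      intro y
      rw [Equiv.Perm.mul_apply]
      by_cases hya : y = a
      · simpa [hya] using hac
      by_cases hyc : y = c
      · simpa [hyc] using hca
      rw [Equiv.swap_apply_of_ne_of_ne hya hyc]
      exact hσ y
    have hxa := (h₂ x ha.symm).symm
    refine (Set.ncard_lt_ncard ?_).not_ge (hmax ⟨_, hτ⟩)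
    exact (Set.ssubset_iff_of_subset fun y hy => hxa.trans (h₂ y (ha.symm.trans hy))).2
      ⟨c, hxa.trans h₁, hc⟩
  ext y
  constructor
  · intro h
    obtain ⟨k, -, -, rfl⟩ := h.exists_pow_eq''
    clear h
    induction k with
    | zero => exact Relation.ReflTransGen.refl
    | succ k ih =>
      refine Relation.ReflTransGen.tail ih (Or.inl ?_)
      rw [pow_succ']
      exact hσ _
  · intro h
    induction h with
    | refl => exact Equiv.Perm.SameCycle.refl _ _
    | @tail a b _ hab ha =>
      rcases hab with hab | hba
      · have hb : E (σ.symm b) b := by simpa using hσ (σ.symm b)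
        have := hswap a (σ.symm b) ha (by simpa using hab) (hE a _ b _ hab hb (hσ a))
        simpa using Equiv.Perm.sameCycle_apply_right.2 this
      · have hb : E (σ.symm a) a := by simpa using hσ (σ.symm a)
        have ha' : σ.SameCycle x (σ.symm a) :=
          Equiv.Perm.sameCycle_apply_right.1 (by simpa using ha)
        exact hswap (σ.symm a) b ha' (hE b _ a _ hba hb (hσ b)) (by simpa using hba)

section EqEdge

variable {F : Type*} [Field F] {l : F} {f : Polynomial F}

theorem eqEdge_iff {x y : F} : EqEdge l f x y ↔ y ^ 2 = f.eval x ∨ l * y ^ 2 = f.eval x := by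
  rw [EqEdge, mul_eq_zero, sub_eq_zero, sub_eq_zero]

theorem eq_zero_of_sq_eq_mul_sq (hl : ∀ z : F, z ^ 2 ≠ l) {c d : F} (h : c ^ 2 = l * d ^ 2) :
    d = 0 := by
  by_contra hd
  exact hl (c / d) (by rw [div_pow, h, mul_div_cancel_right₀ _ (pow_ne_zero 2 hd)])

theorem EqEdge.sq_eq_sq (hl : ∀ z : F, z ^ 2 ≠ l) {a c d : F} (hc : EqEdge l f a c)
    (hd : EqEdge l f a d) : c ^ 2 = d ^ 2 := by
  have hl0 : l ≠ 0 := fun h => hl 0 (by simp [h])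
  have hmixed : ∀ {c d : F}, c ^ 2 = l * d ^ 2 → c ^ 2 = d ^ 2 := by
    intro c d h
    simpa [eq_zero_of_sq_eq_mul_sq hl h] using h
  rcases eqEdge_iff.1 hc with hc | hc <;> rcases eqEdge_iff.1 hd with hd | hd
  · exact hc.trans hd.symm
  · exact hmixed (hc.trans hd.symm)
  · exact (hmixed (hd.trans hc.symm)).symm
  · exact mul_left_cancel₀ hl0 (hc.trans hd.symm)

theorem exists_perm_eqEdge [Fintype F] (hodd : Odd (Fintype.card F)) (hl : ∀ z : F, z ^ 2 ≠ l)
    (hf : Function.Injective fun x => f.eval x) :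
    ∃ σ : Equiv.Perm F, ∀ x, EqEdge l f x (σ x) := by
  classical
  have hl0 : l ≠ 0 := fun h => hl 0 (by simp [h])
  have hchar : ringChar F ≠ 2 := fun h =>
    (Nat.not_even_iff_odd.2 hodd) (Nat.even_iff.2 (FiniteField.even_card_of_char_two h))
  have hsqrt : ∀ u : F, ∃ r : F, IsSquare u → r ^ 2 = u := by
    intro u
    by_cases hu : IsSquare u
    · obtain ⟨r, rfl⟩ := hu
      exact ⟨r, fun _ => pow_two r⟩
    · exact ⟨0, fun h => (hu h).elim⟩
  choose r hr using hsqrt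
  have hlsq : ¬ IsSquare l := fun ⟨z, hz⟩ => hl z (by rw [hz, pow_two])
  have hdiv : ∀ u : F, ¬ IsSquare u → IsSquare (u / l) := by
    intro u hu
    have hu0 : u ≠ 0 := fun h => hu (h ▸ IsSquare.zero)
    rw [← quadraticChar_one_iff_isSquare (div_ne_zero hu0 hl0)]
    have hul : quadraticChar F (u / l) * quadraticChar F l = quadraticChar F u := by
      rw [← map_mul, div_mul_cancel₀ _ hl0]
    rw [quadraticChar_neg_one_iff_not_isSquare.2 hlsq,
      quadraticChar_neg_one_iff_not_isSquare.2 hu] at hul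
    linarith
  set g : F → F := fun x =>
    if IsSquare (f.eval x) then r (f.eval x) else -r (f.eval x / l) with hg
  have hmixed : ∀ u v : F, IsSquare u → ¬ IsSquare v → r u ≠ -r (v / l) := by
    intro u v hu hv h
    have huv : u = v / l := by rw [← hr u hu, ← hr _ (hdiv v hv), h, neg_sq]
    have hru : r u = 0 := by
      rw [← huv] at h
      exact (Ring.eq_self_iff_eq_zero_of_char_ne_two hchar).1 h.symm
    have hu0 : u = 0 := by rw [← hr u hu, hru, zero_pow two_ne_zero]
    rw [hu0, eq_comm, div_eq_zero_iff, or_iff_left hl0] at huv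
    exact hv (huv ▸ IsSquare.zero)
  have hinj : Function.Injective g := by
    intro x y hxy
    apply hf
    simp only [hg] at hxy ⊢
    split_ifs at hxy with hx hy hy
    · rw [← hr _ hx, ← hr _ hy, hxy]
    · exact (hmixed _ _ hx hy hxy).elim
    · exact (hmixed _ _ hy hx hxy.symm).elim
    · refine (div_left_inj' hl0).1 ?_
      rw [← hr _ (hdiv _ hx), ← hr _ (hdiv _ hy), neg_injective hxy]
  refine ⟨Equiv.ofBijective g (Finite.injective_iff_bijective.1 hinj), fun x => ?_⟩
  rw [Equiv.ofBijective_apply, eqEdge_iff]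
  by_cases hx : IsSquare (f.eval x)
  · left
    simp only [hg, if_pos hx, hr _ hx]
  · right
    simp only [hg, if_neg hx, neg_sq, hr _ (hdiv _ hx), mul_div_cancel₀ _ hl0]

end EqEdge

/-- every weakly connected component of `G(l, f)` with `f` a permutation
polynomial has a Hamiltonian cycle. -/
theorem stmt3 {F : Type*} [Field F] [Fintype F]
    (hodd : Odd (Fintype.card F))
    (l : F) (hl : ∀ z : F, z ^ 2 ≠ l)
    (f : Polynomial F) (hf : Function.Bijective fun x => f.eval x) :
    ∀ x : F, ∃ (n : ℕ) (v : ZMod n → F),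
      IsCycle (EqEdge l f) n v ∧ Set.range v = WeakComp (EqEdge l f) x := by
  refine exists_hamiltonian_cycle_weakComp (fun a b c d hac hbc had => ?_)
    (exists_perm_eqEdge hodd hl hf.injective)
  rw [EqEdge, ← hac.sq_eq_sq hl had]
  exact hbc
end

section
/- Let F_q be a finite field of odd order q, let λ ∈ F_q be a non-square element, and let f ∈ F_q[X] be a permutation polynomial of F_q with inverse bijection f⁻¹. Suppose the equational graph G(λ,f) is connected, and suppose that |{(f⁻¹(a²))² : a ∈ F_q}| ≠ (q−1)/2 and |{(f⁻¹(λa²))² : a ∈ F_q}| ≠ (q−1)/2. Then G(λ,f) has no Hamiltonian cycle of Type 1. -/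
open Polynomial

theorem ncard_nonzero_squares {F : Type*} [Field F] [Fintype F] (hF : ringChar F ≠ 2) :
    Set.ncard {b : F | ∃ y : F, y ≠ 0 ∧ y ^ 2 = b} = (Fintype.card F - 1) / 2 := by
  classical
  have hset : {b : F | ∃ y : F, y ≠ 0 ∧ y ^ 2 = b} =
      ((Finset.univ.filter fun b : F => quadraticChar F b = 1 : Finset F) : Set F) := by
    ext b
    simp only [Set.mem_ofPred_eq, Finset.coe_filter, Finset.mem_univ, true_and]
    constructor
    · rintro ⟨y, hy, rfl⟩
      exact quadraticChar_sq_one' hy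
    · intro hb
      have hb0 : b ≠ 0 := fun h => by simp [h] at hb
      obtain ⟨y, rfl⟩ := (quadraticChar_one_iff_isSquare hb0).1 hb
      exact ⟨y, fun h => hb0 (by simp [h]), sq y⟩
  rw [hset, Set.ncard_coe_finset]
  have hsum : ∑ b : F, (quadraticChar F b + (if b = 0 then 0 else 1)) =
      ∑ b : F, (if quadraticChar F b = 1 then 2 else 0) := by
    refine Finset.sum_congr rfl fun b _ => ?_
    by_cases hb : b = 0
    · simp [hb]
    · rcases quadraticChar_dichotomy hb with h | h <;> simp [hb, h]
  rw [Finset.sum_add_distrib, quadraticChar_sum_zero hF, ← Finset.sum_filter,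
    Finset.sum_const, zero_add] at hsum
  have hne : ∑ b : F, (if b = 0 then (0 : ℤ) else 1) = Fintype.card F - 1 := by
    rw [← Finset.add_sum_erase _ _ (Finset.mem_univ (0 : F)),
      Finset.sum_congr rfl fun b hb => if_neg (Finset.ne_of_mem_erase hb)]
    simp [Finset.card_erase_of_mem, Nat.cast_sub Fintype.card_pos]
  rw [hne] at hsum
  simp only [nsmul_eq_mul] at hsum
  omega

theorem sum_range_odd_of_alternating (y : ℕ → ℤ) (n : ℕ)
    (h : ∀ k < 2 * n, y (k + 1) = -y k) : ∑ k ∈ Finset.range (2 * n + 1), y k = y 0 := by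
  induction n with
  | zero => simp
  | succ n ih =>
    rw [show 2 * (n + 1) + 1 = 2 * n + 1 + 1 + 1 by ring, Finset.sum_range_succ,
      Finset.sum_range_succ, ih fun k hk => h k (by omega), h (2 * n + 1) (by omega)]
    ring

/-- If a `±1`-valued sequence followed by a zero has total sum zero and alternates in sign
except possibly at its first step, then it alternates in sign at every step. -/
theorem alternating_of_sum_eq_zero (x : ℕ → ℤ) (m : ℕ) (hm : 0 < m)
    (h : ∀ k, 0 < k → k + 1 < 2 * m → x (k + 1) = -x k) (hlast : x (2 * m) = 0)
    (hsum : ∑ k ∈ Finset.range (2 * m + 1), x k = 0) (k : ℕ) (hk : k + 1 < 2 * m) :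
    x (k + 1) = -x k := by
  rcases Nat.eq_zero_or_pos k with rfl | hpos
  · obtain ⟨n, rfl⟩ : ∃ n, m = n + 1 := ⟨m - 1, by omega⟩
    rw [Finset.sum_range_succ, hlast, show 2 * (n + 1) = 2 * n + 1 + 1 by ring,
      Finset.sum_range_succ', sum_range_odd_of_alternating (fun k => x (k + 1)) n
        fun k hk => h (k + 1) (by omega) (by omega)] at hsum
    simp only [zero_add] at hsum ⊢
    linarith
  · exact h k hpos hk

/-- The squares of the vertices `z` with `f z ∈ u F²` are the nonzero squares, provided `0` is
not such a vertex and every nonzero `y` or its negative is one. -/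
theorem setOf_sq_inverse_eq {F : Type*} [Field F] [Fintype F] [DecidableEq F] (f : Polynomial F)
    (g : F → F) (hg : ∀ x : F, f.eval (g x) = x) (hg' : ∀ x : F, g (f.eval x) = x)
    (u : F) (hu : u ≠ 0) (h0 : f.eval 0 ≠ 0)
    (hu0 : quadraticChar F (f.eval 0) = -quadraticChar F u)
    (H : ∀ y : F, y ≠ 0 → ∃ z, z ^ 2 = y ^ 2 ∧ quadraticChar F (f.eval z) = quadraticChar F u) :
    {b : F | ∃ a : F, (g (u * a ^ 2)) ^ 2 = b} = {b : F | ∃ y : F, y ≠ 0 ∧ y ^ 2 = b} := by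
  ext b
  constructor
  · rintro ⟨a, rfl⟩
    refine ⟨_, fun hz => ?_, rfl⟩
    have hfa : f.eval 0 = u * a ^ 2 := by rw [← hz, hg]
    have ha : a ≠ 0 := fun ha => h0 (by simp [hfa, ha])
    rw [hfa, map_mul, quadraticChar_sq_one' ha] at hu0
    rcases quadraticChar_dichotomy hu with h | h <;> rw [h] at hu0 <;> norm_num at hu0
  · rintro ⟨y, hy, rfl⟩
    obtain ⟨z, hzy, hz⟩ := H y hy
    have hfz : f.eval z ≠ 0 := fun h => by
      rw [h] at hz
      exact hu (quadraticChar_eq_zero_iff.1 (by rw [← hz]; simp))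
    have hsq : quadraticChar F (f.eval z * u) = 1 := by
      rw [map_mul, hz, ← sq, quadraticChar_sq_one hu]
    obtain ⟨r, hr⟩ := (quadraticChar_one_iff_isSquare (mul_ne_zero hfz hu)).1 hsq
    refine ⟨r / u, ?_⟩
    have hfr : u * (r / u) ^ 2 = f.eval z := by
      field_simp
      rw [sq, ← hr, mul_comm]
    rw [hfr, hg', hzy]

theorem quadraticChar_eval_of_eqEdge {F : Type*} [Field F] [Fintype F] [DecidableEq F] {l : F}
    (hl : quadraticChar F l = -1) {f : Polynomial F} {x y : F} (hy : y ≠ 0)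
    (h : EqEdge l f x y) :
    (quadraticChar F (f.eval x) = 1 ∧ f.eval x = y ^ 2 ∧ wt l f x y = 0) ∨
      (quadraticChar F (f.eval x) = -1 ∧ f.eval x = l * y ^ 2 ∧ wt l f x y = 1) := by
  rcases mul_eq_zero.1 h with h | h
  · have h := sub_eq_zero.1 h
    exact Or.inl ⟨by rw [← h, quadraticChar_sq_one' hy], h.symm, if_pos h⟩
  · have h := sub_eq_zero.1 h
    have hχ : quadraticChar F (f.eval x) = -1 := by
      rw [← h, map_mul, quadraticChar_sq_one' hy, hl, mul_one]
    refine Or.inr ⟨hχ, h.symm, if_neg fun h' => ?_⟩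
    rw [← h', quadraticChar_sq_one' hy] at hχ
    norm_num at hχ

/-- if `G(l, f)` is connected, `f` is a permutation polynomial with inverse `g`,
and neither `{(f⁻¹(a²))² : a}` nor `{(f⁻¹(l·a²))² : a}` has exactly `(q-1)/2` elements,
then `G(l, f)` has no Hamiltonian cycle of Type 1. -/
theorem stmt4 {F : Type*} [Field F] [Fintype F]
    (hodd : Odd (Fintype.card F))
    (l : F) (hl : ∀ z : F, z ^ 2 ≠ l)
    (f : Polynomial F) (hf : Function.Bijective fun x => f.eval x)
    (g : F → F) (hg : ∀ x : F, f.eval (g x) = x) (hg' : ∀ x : F, g (f.eval x) = x)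
    (hconn : ∀ x y : F, WeakReach (EqEdge l f) x y)
    (h1 : Set.ncard {b : F | ∃ a : F, (g (a ^ 2)) ^ 2 = b} ≠ (Fintype.card F - 1) / 2)
    (h2 : Set.ncard {b : F | ∃ a : F, (g (l * a ^ 2)) ^ 2 = b} ≠ (Fintype.card F - 1) / 2) :
    ¬ ∃ c : ZMod (Fintype.card F) → F, IsHamCycleOfType l f c 1 := by
  classical
  rintro ⟨c, hc, hE, i0, hi0, -, hT⟩
  have hF : ringChar F ≠ 2 := fun h =>
    Nat.not_even_iff_odd.2 hodd (FiniteField.even_card_iff_char_two.1 h |> Nat.even_iff.2)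
  have hl0 : l ≠ 0 := fun h => hl 0 (by simp [h])
  have hχl : quadraticChar F l = -1 :=
    quadraticChar_neg_one_iff_not_isSquare.2 fun ⟨r, hr⟩ => hl r (by rw [hr, sq])
  obtain ⟨m, hm⟩ := hodd
  have hm0 : 0 < m := by
    have := Fintype.one_lt_card (α := F)
    omega
  let v : ℕ → F := fun k => c (i0 + k)
  have hv0 : v 0 = 0 := by simp [v, hi0]
  have hvq : v (2 * m + 1) = 0 := by
    simp only [v, ← hm, CharP.cast_eq_zero, add_zero, hi0]
  have hvE (k : ℕ) : EqEdge l f (v k) (v (k + 1)) := by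
    have := hE (i0 + k)
    simpa only [v, Nat.cast_add, Nat.cast_one, add_assoc] using this
  have hvinj {i j : ℕ} (hi : i ≤ 2 * m) (hj : j ≤ 2 * m) (h : v i = v j) : i = j := by
    have h := add_left_cancel (hc.1 h)
    rw [ZMod.natCast_eq_natCast_iff] at h
    exact Nat.ModEq.eq_of_lt_of_lt h (by omega) (by omega)
  have hvsurj (y : F) : ∃ i ≤ 2 * m, v i = y := by
    obtain ⟨j, rfl⟩ := hc.2 y
    refine ⟨(j - i0).val, by have := ZMod.val_lt (j - i0); omega, ?_⟩
    simp [v]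
  have hvne {i : ℕ} (h0 : 0 < i) (hi : i ≤ 2 * m) : v i ≠ 0 := fun h => by
    have := hvinj hi (Nat.zero_le _) (h.trans hv0.symm)
    omega
  let x : ℕ → ℤ := fun k => quadraticChar F (f.eval (v k))
  have hedge {k : ℕ} (hk : k < 2 * m) :=
    quadraticChar_eval_of_eqEdge hχl (hvne (Nat.succ_pos k) hk) (hvE k)
  have hx {k : ℕ} (hk : k < 2 * m) : x k = 1 ∨ x k = -1 :=
    (hedge hk).imp And.left And.left
  have hlast : x (2 * m) = 0 := by
    have h := hvE (2 * m)
    rw [hvq] at h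
    have : f.eval (v (2 * m)) = 0 := by simpa [EqEdge] using h
    simp [x, this]
  have hstep : ∀ k, 0 < k → k + 1 < 2 * m → x (k + 1) = -x k := by
    intro k hk hk'
    obtain ⟨i, rfl⟩ : ∃ i, k = i + 1 := ⟨k - 1, by omega⟩
    have hw : wt l f (v (i + 1 + 1)) (v (i + 1 + 1 + 1)) ≠ wt l f (v (i + 1)) (v (i + 1 + 1)) := by
      intro hw
      refine hT 2 (by norm_num) ⟨i, by omega, fun j hj => ?_⟩
      interval_cases j
      · rfl
      · convert hw using 2 <;> simp only [v] <;> congr 1 <;> push_cast <;> ring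
    rcases hedge (k := i + 1) (by omega) with ⟨h, -, h'⟩ | ⟨h, -, h'⟩ <;>
    rcases hedge (k := i + 1 + 1) (by omega) with ⟨k, -, k'⟩ | ⟨k, -, k'⟩
    · exact absurd (k'.trans h'.symm) hw
    · simp only [x, h, k]
    · simp only [x, h, k, neg_neg]
    · exact absurd (k'.trans h'.symm) hw
  have hsum : ∑ k ∈ Finset.range (2 * m + 1), x k = 0 := by
    have h : ∑ y : F, quadraticChar F (f.eval y) = 0 :=
      (hf.sum_comp fun y => quadraticChar F y).trans (quadraticChar_sum_zero hF)
    rw [← h]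
    refine Finset.sum_bij (fun k _ => v k) (fun _ _ => Finset.mem_univ _)
      (fun i hi j hj h => hvinj ?_ ?_ h) (fun y _ => ?_) fun _ _ => rfl
    · have := Finset.mem_range.1 hi
      omega
    · have := Finset.mem_range.1 hj
      omega
    · obtain ⟨i, hi, rfl⟩ := hvsurj y
      exact ⟨i, Finset.mem_range.2 (by omega), rfl⟩
  have halt := alternating_of_sum_eq_zero x m hm0 hstep hlast hsum
  have hpow : ∀ k < 2 * m, x k = (-1) ^ k * x 0 := by
    intro k
    induction k with
    | zero => simp
    | succ k ih =>
      intro hk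
      rw [halt k hk, ih (by omega), pow_succ]
      ring
  have hx0 := hx (k := 0) (by omega)
  have hnext {k : ℕ} (hk : k < 2 * m) (h : x k = x 0) : x (k + 1) = -x 0 := by
    rcases Nat.lt_or_ge (k + 1) (2 * m) with hk' | hk'
    · rw [halt k hk', h]
    · have hodd : Odd k := ⟨m - 1, by omega⟩
      have := hpow k hk
      rw [hodd.neg_one_pow] at this
      omega
  have H : ∀ y : F, y ≠ 0 → ∃ z, z ^ 2 = y ^ 2 ∧ quadraticChar F (f.eval z) = -x 0 := by
    intro y hy
    obtain ⟨i, hi, hiy⟩ := hvsurj y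
    obtain ⟨j, hj, hjy⟩ := hvsurj (-y)
    have hi0 : i ≠ 0 := by
      rintro rfl
      exact hy (hiy.symm.trans hv0)
    have hj0 : j ≠ 0 := by
      rintro rfl
      exact neg_ne_zero.2 hy (hjy.symm.trans hv0)
    obtain ⟨i, rfl⟩ := Nat.exists_eq_succ_of_ne_zero hi0
    obtain ⟨j, rfl⟩ := Nat.exists_eq_succ_of_ne_zero hj0
    have hsq : v (i + 1) ^ 2 = v (j + 1) ^ 2 := by
      rw [hiy, hjy, neg_sq]
    have hij : x i ≠ x j := by
      intro hxij
      have hfij : f.eval (v i) = f.eval (v j) := by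
        rcases hedge hi with ⟨h, h', -⟩ | ⟨h, h', -⟩ <;>
        rcases hedge hj with ⟨k, k', -⟩ | ⟨k, k', -⟩
        · rw [h', k', hsq]
        · simp only [x, h, k] at hxij
          norm_num at hxij
        · simp only [x, h, k] at hxij
          norm_num at hxij
        · rw [h', k', hsq]
      obtain rfl := hvinj (by omega) (by omega) (hf.1 hfij)
      exact hy ((Ring.eq_self_iff_eq_zero_of_char_ne_two hF).1 (hjy.symm.trans hiy))
    by_cases h : x i = x 0
    · exact ⟨y, rfl, by rw [← hiy]; exact hnext hi h⟩
    · have hxj : x j = x 0 := by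
        have := hx hi
        have := hx hj
        omega
      exact ⟨-y, neg_sq y, by rw [← hjy]; exact hnext hj hxj⟩
  have hf0 : f.eval 0 ≠ 0 := fun h => by
    simp [x, hv0, h] at hx0
  have hkey (u : F) (hu : u ≠ 0) (hux : quadraticChar F u = -x 0) :
      Set.ncard {b : F | ∃ a : F, (g (u * a ^ 2)) ^ 2 = b} = (Fintype.card F - 1) / 2 := by
    rw [setOf_sq_inverse_eq f g hg hg' u hu hf0 (by rw [hux, neg_neg, ← hv0]) (by rwa [hux])]
    exact ncard_nonzero_squares hF
  rcases hx0 with h | h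
  · exact h2 (hkey l hl0 (by rw [hχl, h]))
  · exact h1 (by simpa only [one_mul] using hkey 1 one_ne_zero (by rw [map_one, h, neg_neg]))
end

section
/- Let F_q be a finite field of odd order q, let λ ∈ F_q be a non-square element, and let f ∈ F_q[X] be a polynomial of degree one with non-zero constant term. Then any directed path of Type 1 in the equational graph G(λ,f) contains at most ⌊(3/4)q + 17/4⌋ vertices. -/
open Polynomial

/-- In a field of odd order, at most two elements square to `c`. -/
theorem card_filter_sq_eq_le_two {F : Type*} [Field F] [Fintype F] [DecidableEq F] (c : F) :
    (Finset.univ.filter fun u : F => u ^ 2 = c).card ≤ 2 := by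
  rcases (Finset.univ.filter fun u : F => u ^ 2 = c).eq_empty_or_nonempty with h | ⟨i, hi⟩
  · simp [h]
  · refine (Finset.card_le_card (t := {i, -i}) fun u hu => ?_).trans Finset.card_le_two
    simp only [Finset.mem_filter, Finset.mem_univ, true_and] at hi hu
    simpa using sq_eq_sq_iff_eq_or_eq_neg.1 (hu.trans hi.symm)

open Classical in
/-- The nonzero `y` for which `(b + a y)(b - a y)` is a nonzero square. -/
noncomputable def conicSet {F : Type*} [Field F] [Fintype F] (a b : F) : Finset F :=
  Finset.univ.filter fun y => y ≠ 0 ∧ ∃ s, s ≠ 0 ∧ (b + a * y) * (b - a * y) = s ^ 2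

theorem card_le_two_mul_card_conicSet {F : Type*} [Field F] [Fintype F]
    (h2 : (2 : F) ≠ 0) {a b : F} (ha : a ≠ 0) (hb : b ≠ 0) :
    Fintype.card F ≤ 2 * (conicSet a b).card + 5 := by
  classical
  set B : Finset F := {0, 1, -1} ∪ Finset.univ.filter fun u : F => u ^ 2 = -1 with hB
  have hBcard : B.card ≤ 5 := by
    refine (Finset.card_union_le _ _).trans ?_
    have h1 : ({0, 1, -1} : Finset F).card ≤ 3 := Finset.card_le_three
    have h2 := card_filter_sq_eq_le_two (-1 : F)
    omega
  have hmem : ∀ u ∈ Bᶜ, u ≠ 0 ∧ 1 - u ^ 2 ≠ 0 ∧ 1 + u ^ 2 ≠ 0 := by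
    intro u hu
    simp only [hB, Finset.mem_compl, Finset.mem_union, Finset.mem_insert, Finset.mem_singleton,
      Finset.mem_filter, Finset.mem_univ, true_and, not_or] at hu
    obtain ⟨⟨h0, h1, h1'⟩, hi⟩ := hu
    refine ⟨h0, fun h => ?_, fun h => hi (by linear_combination h)⟩
    rcases sq_eq_one_iff.1 (by linear_combination -h : u ^ 2 = 1) with h | h
    · exact h1 h
    · exact h1' h
  have hcard : (Bᶜ).card ≤ 2 * (conicSet a b).card := by
    refine Finset.card_le_mul_card_image_of_maps_to
      (f := fun u => b / a * (2 * u / (1 + u ^ 2))) (fun u hu => ?_) 2 (fun y _ => ?_)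
    · obtain ⟨h0, h1, hi⟩ := hmem u hu
      simp only [conicSet, Finset.mem_filter, Finset.mem_univ, true_and]
      refine ⟨by positivity, b * (1 - u ^ 2) / (1 + u ^ 2), by positivity, ?_⟩
      field_simp
      ring
    · rcases (Finset.filter (fun u => b / a * (2 * u / (1 + u ^ 2)) = y) Bᶜ).eq_empty_or_nonempty
        with h | ⟨w, hw⟩
      · simp [h]
      · refine (Finset.card_le_card (t := {w, w⁻¹}) fun u hu => ?_).trans Finset.card_le_two
        rw [Finset.mem_filter] at hu hw
        obtain ⟨h0, -, hi⟩ := hmem u hu.1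
        obtain ⟨h0', -, hi'⟩ := hmem w hw.1
        have h := mul_left_cancel₀ (div_ne_zero hb ha) (hu.2.trans hw.2.symm)
        rw [div_eq_div_iff hi hi'] at h
        have h' : (u - w) * (1 - u * w) = 0 := by
          apply mul_left_cancel₀ h2
          linear_combination h
        simp only [Finset.mem_insert, Finset.mem_singleton]
        rcases mul_eq_zero.1 h' with h' | h'
        · exact Or.inl (sub_eq_zero.1 h')
        · exact Or.inr (eq_inv_of_mul_eq_one_left (sub_eq_zero.1 h').symm)
  have := Finset.card_add_card_compl B
  omega

/-- If `I` contains no two opposite elements of the symmetric set `T`, then `I` misses at least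
half of `T`. -/
theorem two_mul_card_add_card_le {F : Type*} [Field F] [Fintype F] (T I : Finset F)
    (hT : ∀ y ∈ T, -y ∈ T) (hI : ∀ y ∈ T, y ∈ I → -y ∉ I) :
    2 * I.card + T.card ≤ 2 * Fintype.card F := by
  classical
  have h1 : (T ∩ I).card ≤ (T \ I).card := by
    refine Finset.card_le_card_of_injOn (fun y => -y) (fun y hy => ?_) neg_injective.injOn
    have hy := Finset.mem_inter.1 hy
    exact Finset.mem_sdiff.2 ⟨hT y hy.1, hI y hy.1 hy.2⟩
  have h2 := Finset.card_inter_add_card_sdiff T I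
  have h3 := Finset.card_union_add_card_inter T I
  have h4 := Finset.card_le_univ (T ∪ I)
  omega

/-- for `f` of degree one with non-zero constant term, any path of Type 1
in `G(l, f)` has at most `⌊3q/4 + 17/4⌋` vertices. -/
theorem stmt5 {F : Type*} [Field F] [Fintype F]
    (hodd : Odd (Fintype.card F))
    (l : F) (hl : ∀ z : F, z ^ 2 ≠ l)
    (f : Polynomial F) (hdeg : f.degree = 1) (hconst : f.coeff 0 ≠ 0) :
    ∀ (m : ℕ) (v : ℕ → F), IsPathOn (EqEdge l f) m v →
      PathTypeN (fun k => wt l f (v k) (v (k + 1))) m 1 →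
      m + 1 ≤ (3 * Fintype.card F + 17) / 4 := by
  classical
  rintro m v ⟨hE, hinj⟩ ⟨-, hno⟩
  have h2 : (2 : F) ≠ 0 := by
    refine Ring.two_ne_zero fun h => ?_
    have := FiniteField.even_card_iff_char_two.1 h
    rw [Nat.odd_iff] at hodd
    omega
  set a := f.coeff 1 with ha'
  set b := f.coeff 0 with hb'
  have ha : a ≠ 0 := Polynomial.coeff_ne_zero_of_eq_degree hdeg
  have hf : ∀ x, f.eval x = a * x + b := fun x => by
    conv_lhs => rw [Polynomial.eq_X_add_C_of_degree_le_one hdeg.le]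
    simp [ha', hb']
  set w : ℕ → ℕ := fun k => wt l f (v k) (v (k + 1)) with hw
  have hw01 : ∀ i, i < m → (w i = 0 ∧ v (i + 1) ^ 2 = a * v i + b) ∨
      (w i = 1 ∧ l * v (i + 1) ^ 2 = a * v i + b) := by
    intro i hi
    by_cases h : v (i + 1) ^ 2 = f.eval (v i)
    · exact Or.inl ⟨if_pos h, h.trans (hf _)⟩
    · refine Or.inr ⟨if_neg h, ?_⟩
      rcases mul_eq_zero.1 (hE i hi) with h' | h'
      · exact absurd (sub_eq_zero.1 h') h
      · exact (sub_eq_zero.1 h').trans (hf _)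
  have halt : ∀ i, i + 2 ≤ m → w (i + 1) ≠ w i := by
    intro i hi h
    refine hno 2 one_lt_two ⟨i, hi, fun k hk => ?_⟩
    interval_cases k
    · rfl
    · exact h
  have hne : ∀ i j, i + 1 < m → j + 1 < m → v (i + 1) ∈ conicSet a b →
      v (j + 1) ≠ -v (i + 1) := by
    intro i j hi hj hT hv
    simp only [conicSet, Finset.mem_filter, Finset.mem_univ, true_and] at hT
    obtain ⟨h0, s, hs, hprod⟩ := hT
    have hl' : ∀ x y : F, l * x ^ 2 * y ^ 2 ≠ s ^ 2 := by
      intro x y h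
      have hxy : x * y ≠ 0 := by
        intro h'
        exact hs (pow_eq_zero_iff two_ne_zero |>.1 (by linear_combination -h + l * (x * y) * h'))
      refine hl (s / (x * y)) ?_
      rw [div_pow, ← h, mul_assoc, ← mul_pow, mul_div_cancel_right₀ _ (pow_ne_zero 2 hxy)]
    have hsame : w (i + 1) = w (j + 1) := by
      rcases hw01 _ hi with ⟨e, p⟩ | ⟨e, p⟩ <;> rcases hw01 _ hj with ⟨e', p'⟩ | ⟨e', p'⟩
      · rw [e, e']
      · refine absurd ?_ (hl' (v (i + 1 + 1)) (v (j + 1 + 1)))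
        rw [hv] at p'
        rw [← hprod]
        linear_combination l * v (j + 1 + 1) ^ 2 * p + (a * v (i + 1) + b) * p'
      · refine absurd ?_ (hl' (v (i + 1 + 1)) (v (j + 1 + 1)))
        rw [hv] at p'
        rw [← hprod]
        linear_combination v (j + 1 + 1) ^ 2 * p + (a * v (i + 1) + b) * p'
      · rw [e, e']
    have hi' := halt i hi
    have hj' := halt j hj
    have hsq : v (j + 1) ^ 2 = v (i + 1) ^ 2 := by rw [hv, neg_sq]
    have hpred : v i = v j := by
      apply mul_left_cancel₀ ha
      have hwi := hw01 _ hi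
      rcases hw01 i (by omega) with ⟨e, p⟩ | ⟨e, p⟩ <;>
        rcases hw01 j (by omega) with ⟨e', p'⟩ | ⟨e', p'⟩
      · linear_combination p' - p - hsq
      · omega
      · omega
      · linear_combination p' - p - l * hsq
    have hij := hinj i (by omega) j (by omega) hpred
    rw [← hij] at hv
    exact h0 ((mul_eq_zero.1 (by linear_combination hv : 2 * v (i + 1) = 0)).resolve_left h2)
  have hIcard : ((Finset.range (m - 1)).image fun i => v (i + 1)).card = m - 1 := by
    rw [Finset.card_image_of_injOn, Finset.card_range]
    intro i hi j hj h
    simp only [Finset.coe_range, Set.mem_Iio] at hi hj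
    exact Nat.succ_injective (hinj (i + 1) (by omega) (j + 1) (by omega) h)
  have hcount := two_mul_card_add_card_le (conicSet a b)
    ((Finset.range (m - 1)).image fun i => v (i + 1))
    (by
      intro y hy
      simp only [conicSet, Finset.mem_filter, Finset.mem_univ, true_and] at hy ⊢
      obtain ⟨h0, s, hs, h⟩ := hy
      exact ⟨neg_ne_zero.2 h0, s, hs, by rw [← h]; ring⟩)
    (by
      intro y hy hyI hyI'
      simp only [Finset.mem_image, Finset.mem_range] at hyI hyI'
      obtain ⟨i, hi, rfl⟩ := hyI
      obtain ⟨j, hj, h⟩ := hyI'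
      exact hne i j (by omega) (by omega) hy h)
  have hconic := card_le_two_mul_card_conicSet h2 ha hconst
  rw [hIcard] at hcount
  omega
end

section
/- Let F_q be a finite field of odd order q with q > 17, let λ ∈ F_q be a non-square element, and let f ∈ F_q[X] be a polynomial of degree one. If the equational graph G(λ,f) is connected, then G(λ,f) has no Hamiltonian cycle of Type 1. -/
open Polynomial

/-- Over a finite field with more than nine elements and of odd characteristic, there is a
decomposition `x ^ 2 = y ^ 2 + z ^ 2` of a nonzero square with `y`, `z` nonzero and `y` different
from a given nonzero `e` and from `-e`. -/
lemma exists_sq_sub_sq_eq_sq {F : Type*} [Field F] [Fintype F] (h2 : (2 : F) ≠ 0)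
    (hq : 9 < Fintype.card F) {x e : F} (hx : x ≠ 0) (he : e ≠ 0) :
    ∃ y z : F, y ≠ 0 ∧ z ≠ 0 ∧ y ≠ e ∧ y ≠ -e ∧ x ^ 2 - y ^ 2 = z ^ 2 := by
  let A : F[X] := C (e + x) * X ^ 2 + C (e - x)
  let B : F[X] := C (e - x) * X ^ 2 + C (e + x)
  let P : F[X] := X * (X ^ 2 - 1) * (X ^ 2 + 1) * A * B
  have hA : A ≠ 0 := by
    intro h
    have h1 : A.eval 1 = 0 := by rw [h, eval_zero]
    simp only [A, eval_add, eval_mul, eval_C, eval_pow, eval_X] at h1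
    exact mul_ne_zero h2 he (by linear_combination h1)
  have hB : B ≠ 0 := by
    intro h
    have h1 : B.eval 1 = 0 := by rw [h, eval_zero]
    simp only [B, eval_add, eval_mul, eval_C, eval_pow, eval_X] at h1
    exact mul_ne_zero h2 he (by linear_combination h1)
  have h₁ : (X ^ 2 - 1 : F[X]) ≠ 0 := by
    simpa using X_pow_sub_C_ne_zero (R := F) two_pos 1
  have h₂ : (X ^ 2 + 1 : F[X]) ≠ 0 := by
    simpa using X_pow_add_C_ne_zero (R := F) two_pos 1
  have hP : P ≠ 0 :=
    mul_ne_zero (mul_ne_zero (mul_ne_zero (mul_ne_zero X_ne_zero h₁) h₂) hA) hB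
  have hdeg : P.natDegree ≤ 9 := by
    simp only [P, A, B]
    compute_degree
  obtain ⟨t, ht⟩ := P.exists_eval_ne_zero_of_natDegree_lt_card hP (by
    rw [Cardinal.mk_fintype]
    exact_mod_cast hdeg.trans_lt hq)
  simp only [P, A, B, eval_add, eval_sub, eval_mul, eval_C, eval_pow, eval_X, eval_one,
    mul_ne_zero_iff] at ht
  obtain ⟨⟨⟨⟨h0, hm⟩, hp⟩, hA'⟩, hB'⟩ := ht
  have hm' : 1 - t ^ 2 ≠ 0 := fun h => hm (by linear_combination -h)
  refine ⟨x * (1 - t ^ 2) / (t ^ 2 + 1), 2 * x * t / (t ^ 2 + 1),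
    div_ne_zero (mul_ne_zero hx hm') hp,
    div_ne_zero (mul_ne_zero (mul_ne_zero h2 hx) h0) hp, ?_, ?_, ?_⟩
  · intro h
    rw [div_eq_iff hp] at h
    exact hA' (by linear_combination -h)
  · intro h
    rw [div_eq_iff hp] at h
    exact hB' (by linear_combination h)
  · field_simp
    ring

/-- On a cyclic sequence of vertices, deleting the vertex with index `i0` leaves a path of Type `1`
only if the weights of consecutive edges of this path alternate. -/
lemma PathTypeN.one_alternates {q : ℕ} (hq : 3 < q) (w : ZMod q → ℕ) (i0 : ZMod q)
    (h : PathTypeN (fun k => w (i0 + 1 + (k : ZMod q))) (q - 2) 1) {i : ZMod q}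
    (h0 : i ≠ i0) (h1 : i ≠ i0 + 1) (hm : i ≠ i0 - 1) : w (i - 1) ≠ w i := by
  intro hw
  have : NeZero q := ⟨by omega⟩
  obtain ⟨k, hk, hkq⟩ : ∃ k : ℕ, (k : ZMod q) = i - i0 - 2 ∧ k < q :=
    ⟨(i - i0 - 2).val, ZMod.natCast_zmod_val _, ZMod.val_lt _⟩
  have hcast : ∀ m : ℕ, k + m = q → (k : ZMod q) + m = 0 := by
    intro m hkm
    rw [← Nat.cast_add, hkm, ZMod.natCast_self]
  have hk1 : k + 1 ≠ q := fun hh => h1 (by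
    have := hcast 1 hh
    push_cast at this
    linear_combination this - hk)
  have hk2 : k + 2 ≠ q := fun hh => h0 (by
    have := hcast 2 hh
    push_cast at this
    linear_combination this - hk)
  have hk3 : k + 3 ≠ q := fun hh => hm (by
    have := hcast 3 hh
    push_cast at this
    linear_combination this - hk)
  refine h.2 2 one_lt_two ⟨k, by omega, fun j hj => ?_⟩
  have e0 : i0 + 1 + (k : ZMod q) = i - 1 := by rw [hk]; ring
  have e1 : i0 + 1 + ((k + 1 : ℕ) : ZMod q) = i := by push_cast; rw [hk]; ring
  interval_cases j
  · rfl
  · simp only [e0, e1, hw]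

/-- In `G(l, f)`, edges of different weights leave vertices at which the product of the values of
`f` is not a nonzero square. -/
lemma mul_eval_ne_sq_of_wt_ne {F : Type*} [Field F] {l : F} (hl : ∀ z : F, z ^ 2 ≠ l)
    {f : Polynomial F} {x x' y y' : F} (hx : EqEdge l f x x') (hy : EqEdge l f y y')
    (hw : wt l f x x' ≠ wt l f y y') {z : F} (hz : z ≠ 0) :
    f.eval x * f.eval y ≠ z ^ 2 := by
  have key : ∀ p r : F, p ^ 2 * (l * r ^ 2) ≠ z ^ 2 := by
    intro p r h
    have hp : p ≠ 0 := by rintro rfl; exact hz (by simpa using h.symm)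
    have hr : r ≠ 0 := by rintro rfl; exact hz (by simpa using h.symm)
    refine hl (z / (p * r)) ?_
    rw [div_pow, div_eq_iff (pow_ne_zero 2 (mul_ne_zero hp hr)), ← h]
    ring
  unfold EqEdge at hx hy
  unfold wt at hw
  rcases mul_eq_zero.1 hx with h | h <;> rcases mul_eq_zero.1 hy with h' | h'
  · simp [sub_eq_zero.1 h, sub_eq_zero.1 h'] at hw
  · rw [← sub_eq_zero.1 h, ← sub_eq_zero.1 h']
    exact key _ _
  · rw [← sub_eq_zero.1 h, ← sub_eq_zero.1 h', mul_comm]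
    exact key _ _
  · intro hh
    split_ifs at hw with h₁ h₂ h₂
    · exact hw rfl
    · exact key x' y' (by rw [h₁, sub_eq_zero.1 h', hh])
    · exact key y' x' (by rw [h₂, sub_eq_zero.1 h, mul_comm, hh])
    · exact hw rfl

/-- In `G(l, f)`, edges of the same weight ending at vertices with equal squares leave vertices
with the same value of `f`. -/
lemma eval_eq_of_wt_eq {F : Type*} [Field F] {l : F} {f : Polynomial F} {u v y y' : F}
    (hyy : y ^ 2 = y' ^ 2) (hu : EqEdge l f u y) (hv : EqEdge l f v y')
    (hw : wt l f u y = wt l f v y') : f.eval u = f.eval v := by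
  unfold EqEdge at hu hv
  unfold wt at hw
  split_ifs at hw with h₁ h₂ h₂
  · rw [← h₁, ← h₂, hyy]
  · have h₁' := (mul_eq_zero.1 hu).resolve_left (sub_ne_zero.2 h₁)
    have h₂' := (mul_eq_zero.1 hv).resolve_left (sub_ne_zero.2 h₂)
    linear_combination h₂' - h₁' + l * hyy

lemma wt_eq_zero_or_one {F : Type*} [Field F] (l : F) (f : Polynomial F) (x y : F) :
    wt l f x y = 0 ∨ wt l f x y = 1 := by
  unfold wt
  split_ifs <;> simp

/-- for `q > 17` and `f` of degree one, a connected `G(l, f)` has no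
Hamiltonian cycle of Type 1. -/
theorem stmt6 {F : Type*} [Field F] [Fintype F]
    (hodd : Odd (Fintype.card F)) (hq : 17 < Fintype.card F)
    (l : F) (hl : ∀ z : F, z ^ 2 ≠ l)
    (f : Polynomial F) (hdeg : f.degree = 1)
    (hconn : ∀ x y : F, WeakReach (EqEdge l f) x y) :
    ¬ ∃ c : ZMod (Fintype.card F) → F, IsHamCycleOfType l f c 1 := by
  rintro ⟨c, hc, hE, i0, hi0, hT⟩
  have h2 : (2 : F) ≠ 0 := by
    refine Ring.two_ne_zero fun h => ?_
    have := FiniteField.even_card_iff_char_two.1 h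
    rw [Nat.odd_iff] at hodd
    omega
  have : Fact (1 < Fintype.card F) := ⟨by omega⟩
  obtain ⟨a, b, hf⟩ := exists_eq_X_add_C_of_natDegree_le_one (natDegree_eq_of_degree_eq_some hdeg).le
  have hev : ∀ x, f.eval x = a * x + b := by
    intro x
    simp [hf]
  have ha : a ≠ 0 := by
    rintro rfl
    rw [hf, C_0, zero_mul, zero_add] at hdeg
    exact absurd (hdeg ▸ degree_C_le (a := b)) (by decide)
  have hinj := hc.injective
  have hx0 : a * c (i0 - 1) + b = 0 := by
    have h := hE (i0 - 1)
    rw [sub_add_cancel, hi0, EqEdge, hev] at h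
    refine pow_eq_zero_iff two_ne_zero |>.1 ?_
    linear_combination h
  have hx0ne : c (i0 - 1) ≠ 0 := fun h => by
    simpa using hinj (h.trans hi0.symm)
  have hc1ne : c (i0 + 1) ≠ 0 := fun h => by
    simpa using hinj (h.trans hi0.symm)
  obtain ⟨y, z, hy, hz, hye, hye', hyz⟩ :=
    exists_sq_sub_sq_eq_sq h2 (by omega) hx0ne hc1ne
  have hyx : ∀ y', y' ^ 2 = y ^ 2 → y' ≠ c (i0 - 1) := by
    rintro y' h rfl
    exact hz (by rw [h, sub_self] at hyz; simpa using hyz.symm)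
  obtain ⟨i, hi⟩ := hc.surjective y
  obtain ⟨j, hj⟩ := hc.surjective (-y)
  have halt : ∀ k, c k ≠ 0 → c k ≠ c (i0 + 1) → c k ≠ c (i0 - 1) →
      wt l f (c (k - 1)) (c k) ≠ wt l f (c k) (c (k + 1)) := by
    intro k hk0 hk1 hk2
    have := PathTypeN.one_alternates (by omega) (fun k => wt l f (c k) (c (k + 1))) i0 hT
      (i := k) (fun h => hk0 (h ▸ hi0)) (fun h => hk1 (h ▸ rfl)) (fun h => hk2 (h ▸ rfl))
    simpa using this
  have hwi := halt i (hi ▸ hy) (hi ▸ hye) (hi ▸ hyx y rfl)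
  have hwj := halt j (hj ▸ neg_ne_zero.2 hy) (hj ▸ fun h => hye' (by rw [← h, neg_neg]))
    (hj ▸ hyx (-y) (neg_sq y))
  have hin : wt l f (c (i - 1)) (c i) ≠ wt l f (c (j - 1)) (c j) := by
    intro h
    have hi' := hE (i - 1)
    have hj' := hE (j - 1)
    rw [sub_add_cancel] at hi' hj'
    have huv := eval_eq_of_wt_eq (by rw [hi, hj, neg_sq]) hi' hj' h
    rw [hev, hev] at huv
    have hij : i = j := sub_left_injective (hinj (mul_left_cancel₀ ha (add_right_cancel huv)))
    rw [hij, hj] at hi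
    exact mul_ne_zero h2 hy (by linear_combination -hi)
  have hout : wt l f (c i) (c (i + 1)) ≠ wt l f (c j) (c (j + 1)) := by
    have h₁ := wt_eq_zero_or_one l f (c (i - 1)) (c i)
    have h₂ := wt_eq_zero_or_one l f (c (j - 1)) (c j)
    have h₃ := wt_eq_zero_or_one l f (c i) (c (i + 1))
    have h₄ := wt_eq_zero_or_one l f (c j) (c (j + 1))
    omega
  refine mul_eval_ne_sq_of_wt_ne hl (hE i) (hE j) hout (mul_ne_zero ha hz) ?_
  rw [hev, hev, hi, hj]
  linear_combination a ^ 2 * hyz + (b - a * c (i0 - 1)) * hx0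
end

section
/- Let F_q be a finite field of odd order q, let λ ∈ F_q be a non-square element, and let f ∈ F_q[X] be a permutation polynomial of F_q of the form f = X·w(X²) + a with w ∈ F_q[X] and a ∈ F_q, a ≠ 0. Then any directed path of Type 1 in the equational graph G(λ,f) contains at most ⌊(3/4)q + 17/4⌋ vertices; consequently, if q > 17 and G(λ,f) is connected, then G(λ,f) has no Hamiltonian cycle of Type 1. -/
open Polynomial

section Helpers

variable {F : Type*} [Field F]

theorem EqEdge.eval_eq_of_wt_eq_zero {l : F} {f : F[X]} {x y : F} (h : wt l f x y = 0) :
    f.eval x = y ^ 2 := by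
  unfold wt at h
  split_ifs at h with h'
  exact h'.symm

theorem EqEdge.eval_eq_of_wt_ne_zero {l : F} {f : F[X]} {x y : F} (e : EqEdge l f x y)
    (h : wt l f x y ≠ 0) : f.eval x = l * y ^ 2 := by
  unfold wt at h
  split_ifs at h with h'
  · exact absurd rfl h
  · rcases mul_eq_zero.mp e with e | e
    · exact absurd (sub_eq_zero.mp e) h'
    · exact (sub_eq_zero.mp e).symm

theorem wt_le_one (l : F) (f : F[X]) (x y : F) : wt l f x y ≤ 1 := by
  unfold wt
  split_ifs <;> simp

/-- Consecutive edges of a path of Type 1 have different weights. -/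
theorem PathTypeN.ne_succ {w : ℕ → ℕ} {m : ℕ} (h : PathTypeN w m 1) {i : ℕ} (hi : i + 2 ≤ m) :
    w i ≠ w (i + 1) := by
  intro e
  refine h.2 2 (by norm_num) ⟨i, hi, fun k hk => ?_⟩
  interval_cases k
  · rfl
  · exact e.symm

theorem two_ne_zero_of_odd_card [Fintype F] (hodd : Odd (Fintype.card F)) : (2 : F) ≠ 0 := by
  apply Ring.two_ne_zero
  intro h
  have := FiniteField.even_card_iff_char_two.mp h
  rw [Nat.odd_iff] at hodd
  omega

/-- A coset of the group of nonzero squares contains at most half of the nonzero elements. -/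
theorem two_mul_card_image_mul_sq_add_one_le [Fintype F] [DecidableEq F] (h2 : (2 : F) ≠ 0)
    (l : F) :
    2 * (((Finset.univ : Finset F).erase 0).image fun d => l * d ^ 2).card + 1 ≤
      Fintype.card F := by
  have key := Finset.mul_card_image_le_card (f := fun d : F => l * d ^ 2)
    (s := (Finset.univ : Finset F).erase 0) (n := 2) (by
      intro b hb
      obtain ⟨d, hd, rfl⟩ := Finset.mem_image.mp hb
      have hd0 : d ≠ 0 := (Finset.mem_erase.mp hd).1
      have hne : d ≠ -d := by
        intro e
        exact mul_ne_zero h2 hd0 (by linear_combination e)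
      refine (Finset.card_pair hne).symm.le.trans ?_
      apply Finset.card_le_card
      intro x hx
      rw [Finset.mem_insert, Finset.mem_singleton] at hx
      rcases hx with rfl | rfl <;> simp [hd0])
  rw [Finset.card_erase_of_mem (Finset.mem_univ _), Finset.card_univ] at key
  have : 0 < Fintype.card F := Fintype.card_pos
  omega

/-- If `f(x) + f(-x)` is a nonzero constant, then `f(x) / f(-x)` determines `f(x)`. -/
theorem eval_eq_of_div_eval_neg_eq {f : F[X]} {b : F} (hb : b ≠ 0)
    (hsum : ∀ x, f.eval x + f.eval (-x) = b) {x y : F} (hx : f.eval (-x) ≠ 0)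
    (hy : f.eval (-y) ≠ 0) (h : f.eval x / f.eval (-x) = f.eval y / f.eval (-y)) :
    f.eval x = f.eval y := by
  rw [div_eq_div_iff hx hy] at h
  have h1 := hsum x
  have h2 := hsum y
  apply mul_left_cancel₀ hb
  linear_combination h + f.eval y * h1 - f.eval x * h2

/-- If `y` and `-y` are both inner vertices of a path of Type 1, then `f(y)` and `f(-y)` lie in
different cosets of the squares. -/
theorem exists_div_eval_neg_eq_mul_sq {l : F} (h2 : (2 : F) ≠ 0) (hl0 : l ≠ 0) {f : F[X]}
    (hf : Function.Injective fun x => f.eval x) {m : ℕ} {v : ℕ → F}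
    (hp : IsPathOn (EqEdge l f) m v)
    (ht : PathTypeN (fun k => wt l f (v k) (v (k + 1))) m 1)
    {i j : ℕ} (hi : i + 1 < m) (hj : j + 1 < m) (hij : v (j + 1) = -v (i + 1))
    (h0 : v (i + 1) ≠ 0) (hfi : f.eval (v (i + 1)) ≠ 0) (hfj : f.eval (-v (i + 1)) ≠ 0) :
    ∃ d : F, d ≠ 0 ∧ l * d ^ 2 = f.eval (v (i + 1)) / f.eval (-v (i + 1)) := by
  have hne : i ≠ j := by
    rintro rfl
    exact mul_ne_zero h2 h0 (by linear_combination hij)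
  have hw : wt l f (v i) (v (i + 1)) ≠ wt l f (v j) (v (j + 1)) := by
    intro e
    have hev : f.eval (v i) = f.eval (v j) := by
      by_cases hz : wt l f (v i) (v (i + 1)) = 0
      · rw [EqEdge.eval_eq_of_wt_eq_zero hz, EqEdge.eval_eq_of_wt_eq_zero (e ▸ hz), hij, neg_sq]
      · rw [(hp.1 i (by omega)).eval_eq_of_wt_ne_zero hz,
          (hp.1 j (by omega)).eval_eq_of_wt_ne_zero (e ▸ hz), hij, neg_sq]
    exact hne (hp.2 i (by omega) j (by omega) (hf hev))
  have hwi := ht.ne_succ (i := i) (by omega)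
  have hwj := ht.ne_succ (i := j) (by omega)
  have b1 := wt_le_one l f (v i) (v (i + 1))
  have b2 := wt_le_one l f (v j) (v (j + 1))
  have b3 := wt_le_one l f (v (i + 1)) (v (i + 1 + 1))
  have b4 := wt_le_one l f (v (j + 1)) (v (j + 1 + 1))
  have ei := hp.1 (i + 1) hi
  have ej := hp.1 (j + 1) hj
  rw [← hij] at hfj ⊢
  by_cases hz : wt l f (v (i + 1)) (v (i + 1 + 1)) = 0
  · have e1 := EqEdge.eval_eq_of_wt_eq_zero hz
    have e2 := ej.eval_eq_of_wt_ne_zero (by omega)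
    rw [e1] at hfi ⊢
    rw [e2] at hfj ⊢
    have p0 : v (i + 1 + 1) ≠ 0 := by
      intro h; simp [h] at hfi
    have r0 : v (j + 1 + 1) ≠ 0 := by
      intro h; simp [h] at hfj
    refine ⟨v (i + 1 + 1) / (l * v (j + 1 + 1)), by positivity, ?_⟩
    field_simp
  · have e1 := ei.eval_eq_of_wt_ne_zero hz
    have e2 := EqEdge.eval_eq_of_wt_eq_zero
      (show wt l f (v (j + 1)) (v (j + 1 + 1)) = 0 by omega)
    rw [e1] at hfi ⊢
    rw [e2] at hfj ⊢
    have p0 : v (i + 1 + 1) ≠ 0 := by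
      intro h; simp [h] at hfi
    have r0 : v (j + 1 + 1) ≠ 0 := by
      intro h; simp [h] at hfj
    refine ⟨v (i + 1 + 1) / v (j + 1 + 1), by positivity, ?_⟩
    field_simp

/-- Bound on the length of a path of Type 1 when `f` is a permutation polynomial and
`f(x) + f(-x)` is a nonzero constant. -/
theorem four_mul_card_path_le [Fintype F] (h2 : (2 : F) ≠ 0) {l : F} (hl0 : l ≠ 0) {f : F[X]}
    (hf : Function.Bijective fun x => f.eval x) {b : F} (hb : b ≠ 0)
    (hsum : ∀ x, f.eval x + f.eval (-x) = b) {m : ℕ} {v : ℕ → F}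
    (hp : IsPathOn (EqEdge l f) m v)
    (ht : PathTypeN (fun k => wt l f (v k) (v (k + 1))) m 1) :
    4 * (m + 1) ≤ 3 * Fintype.card F + 13 := by
  classical
  obtain ⟨z, hz⟩ := hf.2 0
  have hz : f.eval z = 0 := hz
  set V : Finset F := (Finset.range (m + 1)).image v with hV
  have cardV : V.card = m + 1 := by
    rw [hV, Finset.card_image_of_injOn, Finset.card_range]
    intro i hi j hj h
    simp only [Finset.coe_range, Set.mem_Iio] at hi hj
    exact hp.2 i (by omega) j (by omega) h
  set V' : Finset F := V.image fun x => -x with hV'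
  have cardV' : V'.card = m + 1 := by
    rw [hV', Finset.card_image_of_injective _ neg_injective, cardV]
  set S : Finset F := {0, v 0, -v 0, v m, -v m, z, -z} with hS
  have cardS : S.card ≤ 7 := (Finset.card_insert_le _ _).trans (Nat.succ_le_succ Finset.card_le_six)
  have hquot : ∀ y ∈ (V ∩ V') \ S, f.eval (-y) ≠ 0 ∧
      f.eval y / f.eval (-y) ∈
        ((Finset.univ : Finset F).erase 0).image fun d => l * d ^ 2 := by
    intro y hy
    simp only [hS, hV', hV, Finset.mem_sdiff, Finset.mem_inter, Finset.mem_image,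
      Finset.mem_range, Finset.mem_insert, Finset.mem_singleton, not_or,
      exists_exists_and_eq_and] at hy
    obtain ⟨⟨⟨i, hi, rfl⟩, j, hj, hij⟩, n0, n1, n2, n3, n4, n5, n6⟩ := hy
    have hij' : v j = -v i := by rw [← hij, neg_neg]
    have hi0 : i ≠ 0 := by rintro rfl; exact n1 rfl
    have him : i ≠ m := by rintro rfl; exact n3 rfl
    have hj0 : j ≠ 0 := by rintro rfl; exact n2 hij.symm
    have hjm : j ≠ m := by rintro rfl; exact n4 hij.symm
    have hfi : f.eval (v i) ≠ 0 := fun h => n5 (hf.1 (h.trans hz.symm))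
    have hfj : f.eval (-v i) ≠ 0 := fun h =>
      n6 (neg_eq_iff_eq_neg.mp (hf.1 (h.trans hz.symm)))
    obtain ⟨i, rfl⟩ := Nat.exists_eq_succ_of_ne_zero hi0
    obtain ⟨j, rfl⟩ := Nat.exists_eq_succ_of_ne_zero hj0
    obtain ⟨d, hd, e⟩ := exists_div_eval_neg_eq_mul_sq h2 hl0 hf.1 hp ht
      (by omega : i + 1 < m) (by omega : j + 1 < m) hij' n0 hfi hfj
    exact ⟨hfj, Finset.mem_image.mpr ⟨d, by simp [hd], e⟩⟩
  have cardD := Finset.card_le_card_of_injOn (fun y => f.eval y / f.eval (-y))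
    (fun y hy => (hquot y hy).2) (fun x hx y hy h => hf.1
      (eval_eq_of_div_eval_neg_eq hb hsum (hquot x hx).1 (hquot y hy).1 h))
  have cardR := two_mul_card_image_mul_sq_add_one_le h2 l
  have h1 := Finset.card_union_add_card_inter V V'
  have h3 : (V ∪ V').card ≤ Fintype.card F := Finset.card_le_univ _
  have h4 := Finset.card_le_card_sdiff_add_card (s := V ∩ V') (t := S)
  omega

end Helpers

/-- for a permutation polynomial `f = X·w(X²) + a` with `a ≠ 0`, any path
of Type 1 in `G(l, f)` has at most `⌊3q/4 + 17/4⌋` vertices; consequently, if `q > 17`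
and `G(l, f)` is connected, there is no Hamiltonian cycle of Type 1. -/
theorem stmt7 {F : Type*} [Field F] [Fintype F]
    (hodd : Odd (Fintype.card F))
    (l : F) (hl : ∀ z : F, z ^ 2 ≠ l)
    (w : Polynomial F) (a : F) (ha : a ≠ 0)
    (f : Polynomial F) (hfw : f = X * w.comp (X ^ 2) + C a)
    (hf : Function.Bijective fun x => f.eval x) :
    (∀ (m : ℕ) (v : ℕ → F), IsPathOn (EqEdge l f) m v →
      PathTypeN (fun k => wt l f (v k) (v (k + 1))) m 1 →
      m + 1 ≤ (3 * Fintype.card F + 17) / 4) ∧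
    (17 < Fintype.card F → (∀ x y : F, WeakReach (EqEdge l f) x y) →
      ¬ ∃ c : ZMod (Fintype.card F) → F, IsHamCycleOfType l f c 1) := by
  have h2 := two_ne_zero_of_odd_card hodd
  have hl0 : l ≠ 0 := fun h => hl 0 (by simp [h])
  have hsum : ∀ x, f.eval x + f.eval (-x) = 2 * a := by
    intro x
    simp [hfw, eval_comp]
    ring
  refine ⟨fun m v hp ht => ?_, ?_⟩
  · have := four_mul_card_path_le h2 hl0 hf (mul_ne_zero h2 ha) hsum hp ht
    omega
  · rintro hq - ⟨c, hc, he, i0, -, ht⟩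
    have hp : IsPathOn (EqEdge l f) (Fintype.card F - 2)
        (fun k : ℕ => c (i0 + 1 + (k : ZMod (Fintype.card F)))) := by
      refine ⟨fun i _ => ?_, fun i hi j hj h => ?_⟩
      · have := he (i0 + 1 + (i : ZMod (Fintype.card F)))
        simpa only [Nat.cast_add, Nat.cast_one, add_assoc] using this
      · have h := (ZMod.natCast_eq_natCast_iff' _ _ _).mp (add_left_cancel (hc.1 h))
        rwa [Nat.mod_eq_of_lt (by omega), Nat.mod_eq_of_lt (by omega)] at h
    have := four_mul_card_path_le h2 hl0 hf (mul_ne_zero h2 ha) hsum hp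
      (by simpa only [Nat.cast_add, Nat.cast_one, add_assoc] using ht)
    omega
end

section
/- Let F_q be a finite field of odd order q, let λ ∈ F_q be a non-square element, and let f ∈ F_q[X] be a permutation polynomial of F_q. For any Hamiltonian cycle H of any weakly connected component of the equational graph G(λ,f), the binary sequence of edge weights along H is balancing: the number of edges of weight 0 in H and the number of edges of weight 1 in H differ by at most 1. -/
open Polynomial

/-- A weakly connected component is closed under predecessors. -/
theorem WeakComp.mem_of_edge {V : Type*} {E : V → V → Prop} {a x y : V}
    (hy : y ∈ WeakComp E a) (h : E x y) : x ∈ WeakComp E a :=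
  Relation.ReflTransGen.tail hy (Or.inr h)

theorem wt_eq_zero_iff {F : Type*} [Field F] {l : F} {f : Polynomial F} {x y : F} :
    wt l f x y = 0 ↔ y ^ 2 = f.eval x := by
  simp [wt]

theorem wt_eq_one_iff {F : Type*} [Field F] {l : F} {f : Polynomial F} {x y : F} :
    wt l f x y = 1 ↔ y ^ 2 ≠ f.eval x := by
  simp [wt]

/-- For a non-square `l`, a nonzero element of the form `l * y ^ 2` is not a square. -/
theorem sq_ne_mul_sq {F : Type*} [Field F] {l : F} (hl : ∀ z : F, z ^ 2 ≠ l) {y z : F}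
    (hy : y ≠ 0) : z ^ 2 ≠ l * y ^ 2 := by
  intro h
  apply hl (z / y)
  rw [div_pow, h, mul_div_cancel_right₀ _ (pow_ne_zero 2 hy)]

/-- along any Hamiltonian cycle of any weakly connected component of
`G(l, f)` with `f` a permutation polynomial, the numbers of edges of weight 0 and of
weight 1 differ by at most 1. -/
theorem stmt9 {F : Type*} [Field F] [Fintype F]
    (hodd : Odd (Fintype.card F))
    (l : F) (hl : ∀ z : F, z ^ 2 ≠ l)
    (f : Polynomial F) (hf : Function.Bijective fun x => f.eval x) :
    ∀ (n : ℕ) (v : ZMod n → F), IsCycle (EqEdge l f) n v →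
      Set.range v = WeakComp (EqEdge l f) (v 0) →
      |(Nat.card {i : ZMod n // wt l f (v i) (v (i + 1)) = 0} : ℤ) -
        (Nat.card {i : ZMod n // wt l f (v i) (v (i + 1)) = 1} : ℤ)| ≤ 1 := by
  rintro n v ⟨hn, hv, hE⟩ hrange
  have : NeZero n := ⟨hn.ne'⟩
  have hl0 : l ≠ 0 := fun h => hl 0 (by simp [h])
  have hpred : ∀ (i : ZMod n) (c : F), (v i ^ 2 - c) * (l * v i ^ 2 - c) = 0 →
      ∃ j, f.eval (v j) = c := by
    intro i c hc
    obtain ⟨x, rfl⟩ := hf.2 c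
    have hx : x ∈ Set.range v := by
      rw [hrange]
      exact WeakComp.mem_of_edge (hrange ▸ Set.mem_range_self i) hc
    obtain ⟨j, rfl⟩ := hx
    exact ⟨j, rfl⟩
  have hinj : ∀ {i j : ZMod n}, f.eval (v i) = f.eval (v j) → i = j :=
    fun h => hv (hf.1 h)
  have hone : ∀ i, wt l f (v i) (v (i + 1)) = 1 →
      v (i + 1) ≠ 0 ∧ l * v (i + 1) ^ 2 = f.eval (v i) := by
    intro i hi
    have hi' := wt_eq_one_iff.1 hi
    have h := (mul_eq_zero.1 (hE i)).resolve_left (sub_ne_zero.2 hi')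
    refine ⟨fun h0 => hi' ?_, sub_eq_zero.1 h⟩
    simpa [h0] using sub_eq_zero.1 h
  have hle : Nat.card {i : ZMod n // wt l f (v i) (v (i + 1)) = 1} ≤
      Nat.card {i : ZMod n // wt l f (v i) (v (i + 1)) = 0} := by
    have key : ∀ i : {i : ZMod n // wt l f (v i) (v (i + 1)) = 1},
        ∃ j : {i : ZMod n // wt l f (v i) (v (i + 1)) = 0},
          l * f.eval (v j) = f.eval (v i) := by
      rintro ⟨i, hi⟩
      obtain ⟨h0, h1⟩ := hone i hi
      obtain ⟨j, hj⟩ := hpred (i + 1) (v (i + 1) ^ 2) (by simp)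
      refine ⟨⟨j, ?_⟩, by simp only [hj, h1]⟩
      rw [wt_eq_zero_iff]
      by_contra hne
      obtain ⟨h0', h1'⟩ := hone j (wt_eq_one_iff.2 hne)
      exact sq_ne_mul_sq hl h0' (hj.symm.trans h1'.symm)
    choose g hg using key
    refine Nat.card_le_card_of_injective g fun i j h => Subtype.ext (hinj ?_)
    rw [← hg, ← hg, h]
  have hge : Nat.card {i : ZMod n // wt l f (v i) (v (i + 1)) = 0} ≤
      Nat.card {i : ZMod n // wt l f (v i) (v (i + 1)) = 1} + 1 := by
    have key : ∀ i : {i : ZMod n // wt l f (v i) (v (i + 1)) = 0},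
        ∃ j : Option {i : ZMod n // wt l f (v i) (v (i + 1)) = 1},
          (j.elim 0 fun j => f.eval (v j)) = l * f.eval (v i) := by
      rintro ⟨i, hi⟩
      rw [wt_eq_zero_iff] at hi
      by_cases h0 : v (i + 1) = 0
      · exact ⟨none, by simp [← hi, h0]⟩
      obtain ⟨j, hj⟩ := hpred (i + 1) (l * v (i + 1) ^ 2) (by simp)
      refine ⟨some ⟨j, ?_⟩, by simp [hj, hi]⟩
      rw [wt_eq_one_iff, hj]
      exact sq_ne_mul_sq hl h0
    choose g hg using key
    rw [← Finite.card_option]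
    refine Nat.card_le_card_of_injective g fun i j h => Subtype.ext (hinj ?_)
    apply mul_left_cancel₀ hl0
    rw [← hg, ← hg, h]
  rw [abs_le]
  omega
end

section
/- Let F_q be a finite field of odd order q and let λ ∈ F_q be a non-square element. For any a, b ∈ F_q with a ≠ 0, the equational graph G(λ, aX + b) is isomorphic to the equational graph G(λ, X + a⁻²b); indeed, the map ψ : F_q → F_q given by ψ(x) = a⁻¹x is a bijection such that there is an edge from x to y in G(λ, aX + b) if and only if there is an edge from ψ(x) to ψ(y) in G(λ, X + a⁻²b). -/
open Polynomial

/-- `ψ(x) = a⁻¹·x` is an isomorphism from `G(l, aX + b)` to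
`G(l, X + a⁻²·b)`. -/
theorem stmt10 {F : Type*} [Field F] [Fintype F]
    (hodd : Odd (Fintype.card F))
    (l : F) (hl : ∀ z : F, z ^ 2 ≠ l)
    (a b : F) (ha : a ≠ 0) :
    Function.Bijective (fun x : F => a⁻¹ * x) ∧
    ∀ x y : F, EqEdge l (C a * X + C b) x y ↔
      EqEdge l (X + C (a⁻¹ ^ 2 * b)) (a⁻¹ * x) (a⁻¹ * y) := by
  refine ⟨mulLeft_bijective₀ _ (inv_ne_zero ha), fun x y => ?_⟩
  have key : ((a⁻¹ * y) ^ 2 - (a⁻¹ * x + a⁻¹ ^ 2 * b)) *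
      (l * (a⁻¹ * y) ^ 2 - (a⁻¹ * x + a⁻¹ ^ 2 * b)) =
      a⁻¹ ^ 4 * ((y ^ 2 - (a * x + b)) * (l * y ^ 2 - (a * x + b))) := by
    field_simp
  simp only [EqEdge, eval_add, eval_mul, eval_C, eval_X]
  rw [key, mul_eq_zero_iff_left (pow_ne_zero 4 (inv_ne_zero ha))]
end

section
/- Let F_q be a finite field of odd order q and let λ ∈ F_q be a non-square element. For any a ∈ F_q, the equational graph G(λ, X + a) is isomorphic to the equational graph G(λ⁻¹, X + λa); indeed, the map ψ : F_q → F_q given by ψ(x) = λx is a bijection such that there is an edge from x to y in G(λ, X + a) if and only if there is an edge from ψ(x) to ψ(y) in G(λ⁻¹, X + λa). -/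
open Polynomial

/-- `ψ(x) = l·x` is an isomorphism from `G(l, X + a)` to
`G(l⁻¹, X + l·a)`. -/
theorem stmt11 {F : Type*} [Field F] [Fintype F]
    (hodd : Odd (Fintype.card F))
    (l : F) (hl : ∀ z : F, z ^ 2 ≠ l)
    (a : F) :
    Function.Bijective (fun x : F => l * x) ∧
    ∀ x y : F, EqEdge l (X + C a) x y ↔
      EqEdge l⁻¹ (X + C (l * a)) (l * x) (l * y) := by
  have hl0 : l ≠ 0 := fun h => hl 0 (by simp [h])
  refine ⟨mulLeft_bijective₀ l hl0, fun x y => ?_⟩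
  have key : ((l * y) ^ 2 - (l * x + l * a)) * (l⁻¹ * (l * y) ^ 2 - (l * x + l * a)) =
      l ^ 2 * ((y ^ 2 - (x + a)) * (l * y ^ 2 - (x + a))) := by
    field_simp
  simp only [EqEdge, eval_add, eval_X, eval_C]
  rw [key, mul_eq_zero_iff_left (pow_ne_zero 2 hl0)]
end

section
/- Let F_q be a finite field of odd order q, let λ ∈ F_q be a non-square element, and let χ be the quadratic character of F_q (with χ(0) = 0). Define S_λ = {a ∈ F_q : the equational graph G(λ, X + a) has a fixed vertex}. Then |S_λ| = (1/4)(3q + 1 + χ(λ − 1) − χ(1 − λ)). In particular, |S_λ| = (3q + 1)/4 if −1 is a square in F_q, and otherwise |S_λ| equals (3q − 1)/4 or (3q + 3)/4. -/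
open Polynomial

theorem qchar_eq_quadraticChar {F : Type*} [Field F] [Fintype F] [DecidableEq F] (u : F) :
    qchar u = quadraticChar F u := by
  have h : (∃ z : F, z ^ 2 = u) ↔ IsSquare u := by
    simp only [isSquare_iff_exists_sq, eq_comm]
  unfold qchar
  rw [quadraticChar_apply, quadraticCharFun]
  simp only [h]

theorem ringChar_ne_two_of_odd_card {F : Type*} [Field F] [Fintype F]
    (hodd : Odd (Fintype.card F)) : ringChar F ≠ 2 := fun h => by
  have := FiniteField.even_card_iff_char_two.mp h
  have := Nat.odd_iff.mp hodd
  omega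

theorem bijective_add_mul {F : Type*} [Field F] (b : F) {c : F} (hc : c ≠ 0) :
    Function.Bijective fun x : F => b + c * x :=
  ((Equiv.mulLeft₀ c hc).trans (Equiv.addLeft b)).bijective

section Sums

variable {F : Type*} [Field F] [Fintype F] [DecidableEq F]

theorem quadraticChar_sum_linear (hF : ringChar F ≠ 2) (b : F) {c : F} (hc : c ≠ 0) :
    ∑ x : F, quadraticChar F (b + c * x) = 0 := by
  rw [(bijective_add_mul b hc).sum_comp (fun y => quadraticChar F y)]
  exact quadraticChar_sum_zero hF

theorem quadraticChar_sum_mul_linear (hF : ringChar F ≠ 2) (b : F) {c : F} (hc : c ≠ 0) :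
    ∑ x : F, quadraticChar F x * quadraticChar F (c + b * x) = -quadraticChar F b := by
  have key (x : F) : quadraticChar F x * quadraticChar F (c + b * x) =
      quadraticChar F (b + c * x⁻¹) - if x = 0 then quadraticChar F b else 0 := by
    by_cases hx : x = 0
    · simp [hx]
    · have h : x * (c + b * x) = x ^ 2 * (b + c * x⁻¹) := by field_simp; ring
      rw [← map_mul, h, map_mul, quadraticChar_sq_one' hx]
      simp [hx]
  have hinv : ∑ x : F, quadraticChar F (b + c * x⁻¹) = 0 := by
    rw [(inv_involutive (G := F)).bijective.sum_comp (fun y => quadraticChar F (b + c * y))]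
    exact quadraticChar_sum_linear hF b hc
  simp only [key, Finset.sum_sub_distrib, hinv]
  simp

/-- The number of `x` for which `x` and `1 - l + l * x` are both non-squares. -/
theorem four_mul_card_both_nonsquare (hF : ringChar F ≠ 2) {l : F}
    (hl : quadraticChar F l = -1) :
    4 * ∑ x : F, (if quadraticChar F x = -1 ∧ quadraticChar F ((1 - l) + l * x) = -1
      then (1 : ℤ) else 0) =
      Fintype.card F - 1 + quadraticChar F (1 - l) - quadraticChar F (l - 1) := by
  have hl0 : l ≠ 0 := by rintro rfl; simp at hl
  have hl1 : 1 - l ≠ 0 := fun h => by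
    rw [← sub_eq_zero.mp h, map_one] at hl
    norm_num at hl
  have hroot (x : F) : (1 - l) + l * x = 0 ↔ x = (l - 1) / l := by
    rw [eq_div_iff hl0]
    constructor <;> intro h <;> linear_combination h
  have hd : quadraticChar F ((l - 1) / l) = -quadraticChar F (l - 1) := by
    have h : quadraticChar F ((l - 1) / l) * quadraticChar F l = quadraticChar F (l - 1) := by
      rw [← map_mul, div_mul_cancel₀ _ hl0]
    rw [hl] at h
    linarith
  have hd0 : (l - 1) / l ≠ 0 := div_ne_zero (sub_ne_zero.mpr (sub_ne_zero.mp hl1).symm) hl0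
  have key (x : F) : 4 * (if quadraticChar F x = -1 ∧ quadraticChar F ((1 - l) + l * x) = -1
      then (1 : ℤ) else 0) =
      1 - quadraticChar F x - quadraticChar F ((1 - l) + l * x)
        + quadraticChar F x * quadraticChar F ((1 - l) + l * x)
        - (if x = 0 then 1 - quadraticChar F (1 - l) else 0)
        - (if x = (l - 1) / l then 1 + quadraticChar F (l - 1) else 0) := by
    by_cases hx : x = 0
    · simp [hx, hd0.symm]
    by_cases hy : x = (l - 1) / l
    · have h0 := (hroot x).mpr hy
      rw [h0, if_neg hx, if_pos hy, hy, hd]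
      simp
    · have h0 := (hroot x).not.mpr hy
      rw [if_neg hx, if_neg hy]
      rcases quadraticChar_dichotomy hx with h | h <;>
      rcases quadraticChar_dichotomy h0 with h' | h' <;> simp [h, h']
  rw [Finset.mul_sum]
  simp only [key, Finset.sum_sub_distrib, Finset.sum_add_distrib, quadraticChar_sum_zero hF,
    quadraticChar_sum_linear hF _ hl0, quadraticChar_sum_mul_linear hF _ hl1, hl,
    Finset.sum_ite_eq', Finset.mem_univ, if_true, Finset.sum_const, Finset.card_univ]
  simp
  ring

theorem exists_quadratic_root_iff (hF : ringChar F ≠ 2) {l : F} (hl : l ≠ 0) (a : F) :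
    (∃ x : F, l * x ^ 2 - (x + a) = 0) ↔ quadraticChar F (1 + 4 * l * a) ≠ -1 := by
  have : NeZero (2 : F) := ⟨Ring.two_ne_zero hF⟩
  have hdisc : discrim l (-1) (-a) = 1 + 4 * l * a := by unfold discrim; ring
  rw [ne_eq, quadraticChar_neg_one_iff_not_isSquare, not_not]
  constructor
  · rintro ⟨x, hx⟩
    refine ⟨2 * l * x + -1, ?_⟩
    rw [← hdisc, ← sq]
    exact discrim_eq_sq_of_quadratic_eq_zero (by linear_combination hx)
  · rintro ⟨s, hs⟩
    obtain ⟨x, hx⟩ := exists_quadratic_eq_zero hl ⟨s, hdisc.trans hs⟩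
    exact ⟨x, by linear_combination hx⟩

theorem exists_fixed_vertex_iff (hF : ringChar F ≠ 2) {l : F} (hl : l ≠ 0) (a : F) :
    (∃ x : F, EqEdge l (X + C a) x x) ↔
      ¬(quadraticChar F (1 + 4 * a) = -1 ∧
        quadraticChar F ((1 - l) + l * (1 + 4 * a)) = -1) := by
  have h1 := exists_quadratic_root_iff hF one_ne_zero a
  have h2 := exists_quadratic_root_iff hF hl a
  rw [mul_one] at h1
  rw [show (1 - l) + l * (1 + 4 * a) = 1 + 4 * l * a by ring, not_and_or, ← ne_eq, ← ne_eq,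
    ← h1, ← h2, ← exists_or]
  simp [EqEdge]

theorem four_mul_ncard_fixed_vertex (hF : ringChar F ≠ 2) {l : F}
    (hl : quadraticChar F l = -1) :
    4 * (Set.ncard {a : F | ∃ x : F, EqEdge l (X + C a) x x} : ℤ) =
      3 * (Fintype.card F : ℤ) + 1 + quadraticChar F (l - 1) - quadraticChar F (1 - l) := by
  have hl0 : l ≠ 0 := by rintro rfl; simp at hl
  have h4 : (4 : F) ≠ 0 := by
    rw [show (4 : F) = 2 ^ 2 by norm_num]
    exact pow_ne_zero 2 (Ring.two_ne_zero hF)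
  let p : F → Prop := fun x =>
    quadraticChar F x = -1 ∧ quadraticChar F ((1 - l) + l * x) = -1
  have hset : {a : F | ∃ x : F, EqEdge l (X + C a) x x} =
      ((Finset.univ.filter fun a : F => ¬p (1 + 4 * a) : Finset F) : Set F) := by
    ext a
    simp only [Set.mem_ofPred_eq, exists_fixed_vertex_iff hF hl0, Finset.coe_filter,
      Finset.mem_univ, true_and, p]
  have hsplit := Finset.card_filter_add_card_filter_not (s := Finset.univ)
    (fun a : F => p (1 + 4 * a))
  have hcount := four_mul_card_both_nonsquare hF hl
  have hcard : ((Finset.univ.filter fun a : F => p (1 + 4 * a)).card : ℤ) =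
      ∑ x : F, if p x then (1 : ℤ) else 0 := by
    rw [Finset.natCast_card_filter]
    exact (bijective_add_mul 1 h4).sum_comp (fun x => if p x then (1 : ℤ) else 0)
  rw [← hcard] at hcount
  rw [hset, Set.ncard_coe_finset]
  rw [Finset.card_univ] at hsplit
  zify at hsplit
  linarith

end Sums

/-- the number of `a ∈ F` such that `G(l, X + a)` has a fixed vertex is
`(1/4)·(3q + 1 + χ(l - 1) - χ(1 - l))`; in particular it is `(3q + 1)/4` when `-1` is a
square, and `(3q - 1)/4` or `(3q + 3)/4` otherwise. -/
theorem stmt12 {F : Type*} [Field F] [Fintype F]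
    (hodd : Odd (Fintype.card F))
    (l : F) (hl : ∀ z : F, z ^ 2 ≠ l) :
    (4 * (Set.ncard {a : F | ∃ x : F, EqEdge l (X + C a) x x} : ℤ) =
      3 * (Fintype.card F : ℤ) + 1 + qchar (l - 1) - qchar (1 - l)) ∧
    ((∃ z : F, z ^ 2 = -1) →
      4 * (Set.ncard {a : F | ∃ x : F, EqEdge l (X + C a) x x} : ℤ) =
        3 * (Fintype.card F : ℤ) + 1) ∧
    (¬(∃ z : F, z ^ 2 = -1) →
      4 * (Set.ncard {a : F | ∃ x : F, EqEdge l (X + C a) x x} : ℤ) =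
        3 * (Fintype.card F : ℤ) - 1 ∨
      4 * (Set.ncard {a : F | ∃ x : F, EqEdge l (X + C a) x x} : ℤ) =
        3 * (Fintype.card F : ℤ) + 3) := by
  classical
  have hF := ringChar_ne_two_of_odd_card hodd
  have hlchar : quadraticChar F l = -1 := by
    rw [quadraticChar_neg_one_iff_not_isSquare]
    rintro ⟨z, hz⟩
    exact hl z (by rw [hz, sq])
  have hl1 : l - 1 ≠ 0 := fun h => hl 1 (by linear_combination -h)
  have hneg : quadraticChar F (1 - l) = quadraticChar F (-1) * quadraticChar F (l - 1) := by
    rw [← map_mul]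
    congr 1
    ring
  have hsq : (∃ z : F, z ^ 2 = -1) ↔ IsSquare (-1 : F) := by
    simp only [isSquare_iff_exists_sq, eq_comm]
  rw [qchar_eq_quadraticChar, qchar_eq_quadraticChar, four_mul_ncard_fixed_vertex hF hlchar,
    hneg, hsq]
  refine ⟨rfl, fun h => ?_, fun h => ?_⟩
  · rw [(quadraticChar_one_iff_isSquare (neg_ne_zero.mpr one_ne_zero)).mpr h]
    ring
  · rw [quadraticChar_neg_one_iff_not_isSquare.mpr h]
    rcases quadraticChar_dichotomy hl1 with h' | h' <;> rw [h']
    · right; ring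
    · left; ring
end

section
/- Let F_q be a finite field of odd order q and let λ ∈ F_q be a non-square element. For any a ∈ F_q, the equational graph G(λ, X + a) has a weakly connected component with exactly three vertices if and only if either (λ = 2 and a = 1) or (λ = 1/2 and a = 2). In particular, if 2 is a non-square element in F_q, then the vertices 0, 1, −1 form a connected component of G(2, X + 1), and the vertices 0, 2, −2 form a connected component of G(1/2, X + 2). -/
open Polynomial

theorem eqEdge_X_add_C {F : Type*} [Field F] {l a x y : F} :
    EqEdge l (X + C a) x y ↔ y ^ 2 = x + a ∨ l * y ^ 2 = x + a := by
  simp [EqEdge, sub_eq_zero]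

theorem mem_weakComp_self {V : Type*} (E : V → V → Prop) (x : V) : x ∈ WeakComp E x :=
  Relation.ReflTransGen.refl

theorem mem_weakComp_of_edge {V : Type*} {E : V → V → Prop} {x u v : V}
    (hu : u ∈ WeakComp E x) (h : E u v ∨ E v u) : v ∈ WeakComp E x :=
  Relation.ReflTransGen.tail hu h

/-- A set closed under the edges in both directions contains the weak component of each
of its elements. -/
theorem weakComp_subset {V : Type*} {E : V → V → Prop} {S : Set V} {x : V} (hx : x ∈ S)
    (hS : ∀ u v, E u v → (u ∈ S ↔ v ∈ S)) : WeakComp E x ⊆ S := by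
  intro y hy
  induction hy with
  | refl => exact hx
  | tail _ h ih =>
    rcases h with h | h
    · exact (hS _ _ h).1 ih
    · exact (hS _ _ h).2 ih

/-- A three-element set stable under negation contains `0`. -/
theorem zero_mem_of_ncard_eq_three {F : Type*} [Field F] (h2 : (2 : F) ≠ 0) {S : Set F}
    (hS : S.ncard = 3) (hneg : ∀ y ∈ S, -y ∈ S) : (0 : F) ∈ S := by
  obtain ⟨u, v, w, huv, huw, hvw, rfl⟩ := Set.ncard_eq_three.1 hS
  have hu := hneg u (by simp)
  have hv := hneg v (by simp)
  have hw := hneg w (by simp)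
  simp only [Set.mem_insert_iff, Set.mem_singleton_iff] at hu hv hw ⊢
  grind

theorem ncard_zero_self_neg {F : Type*} [Field F] (h2 : (2 : F) ≠ 0) {b : F} (hb : b ≠ 0) :
    ({0, b, -b} : Set F).ncard = 3 := by
  refine Set.ncard_eq_three.2 ⟨0, b, -b, hb.symm, (neg_ne_zero.2 hb).symm, fun h => ?_, rfl⟩
  exact mul_ne_zero h2 hb (by linear_combination h)

/-- Three-element weak components of `G(l, X + a)` occur only for `(l, a) = (2, 1)` and
`(l, a) = (1/2, 2)`. -/
theorem eq_of_ncard_weakComp_eq_three {F : Type*} [Field F] (h2 : (2 : F) ≠ 0) {l a x : F}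
    (hl : ∀ z : F, z ^ 2 ≠ l) (h : (WeakComp (EqEdge l (X + C a)) x).ncard = 3) :
    (l = 2 ∧ a = 1) ∨ (l = 1 / 2 ∧ a = 2) := by
  have hl0 : l ≠ 0 := fun h0 => hl 0 (by simp [h0])
  have hl1 : l ≠ 1 := fun h1 => hl 1 (by simp [h1])
  set S := WeakComp (EqEdge l (X + C a)) x with hS
  have hsq : ∀ y ∈ S, y ^ 2 - a ∈ S := fun y hy =>
    mem_weakComp_of_edge hy (Or.inr (eqEdge_X_add_C.2 (Or.inl (by ring))))
  have hlsq : ∀ y ∈ S, l * y ^ 2 - a ∈ S := fun y hy =>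
    mem_weakComp_of_edge hy (Or.inr (eqEdge_X_add_C.2 (Or.inr (by ring))))
  have hneg : ∀ y ∈ S, -y ∈ S := fun y hy =>
    mem_weakComp_of_edge (hsq y hy) (Or.inl (eqEdge_X_add_C.2 (Or.inl (by ring))))
  have h0 : (0 : F) ∈ S := zero_mem_of_ncard_eq_three h2 h hneg
  have ha : a ≠ 0 := by
    rintro rfl
    have hedge : ∀ u v, EqEdge l (X + C 0) u v → (u = 0 ↔ v = 0) := by
      intro u v huv
      rw [eqEdge_X_add_C, add_zero] at huv
      rcases huv with rfl | rfl <;> simp [hl0]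
    by_cases hx : x = 0
    · have hsub : S ⊆ {0} := weakComp_subset hx hedge
      have hle := Set.ncard_le_ncard hsub
      rw [h, Set.ncard_singleton] at hle
      omega
    · have hsub : S ⊆ {0}ᶜ := weakComp_subset hx fun u v huv => not_congr (hedge u v huv)
      exact hsub h0 rfl
  have hna : -a ∈ S := by simpa using hsq 0 h0
  have hpa : a ∈ S := by simpa using hneg _ hna
  have hSeq : {0, a, -a} = S := by
    refine Set.eq_of_subset_of_ncard_le ?_ ?_ (Set.finite_of_ncard_ne_zero (by omega))
    · rintro y (rfl | rfl | rfl) <;> assumption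
    · rw [h, ncard_zero_self_neg h2 ha]
  have h3 := hsq a hpa
  have h4 := hlsq a hpa
  rw [← hSeq] at h3 h4
  simp only [Set.mem_insert_iff, Set.mem_singleton_iff] at h3 h4
  have h3' : a = 1 ∨ a = 2 := by
    clear * - ha h3
    grind
  have h4' : l * a = 1 ∨ l * a = 2 := by
    clear * - ha hl0 h4
    grind
  clear * - h2 hl1 h3' h4'
  grind

/-- If `2` is a non-square, then `{0, 1, -1}` is a weak component of `G(2, X + 1)`. -/
theorem weakComp_two_X_add_one {F : Type*} [Field F] (h2 : ∀ z : F, z ^ 2 ≠ 2) :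
    WeakComp (EqEdge (2 : F) (X + C 1)) 0 = {0, 1, -1} := by
  have h20 : (2 : F) ≠ 0 := fun h => h2 0 (by simp [h])
  apply Set.Subset.antisymm
  · refine weakComp_subset (by simp) fun u v h => ?_
    have := h2 v
    have := h2 (2 * v)
    rw [eqEdge_X_add_C] at h
    simp only [Set.mem_insert_iff, Set.mem_singleton_iff]
    clear h2
    grind
  · rintro y (rfl | rfl | rfl)
    · exact mem_weakComp_self _ _
    all_goals
      refine mem_weakComp_of_edge (mem_weakComp_self _ _) (Or.inl ?_)
      rw [eqEdge_X_add_C]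
      norm_num

/-- If `2` is a non-square, then `{0, 2, -2}` is a weak component of `G(1/2, X + 2)`. -/
theorem weakComp_half_X_add_two {F : Type*} [Field F] (h2 : ∀ z : F, z ^ 2 ≠ 2) :
    WeakComp (EqEdge (1 / 2 : F) (X + C 2)) 0 = {0, 2, -2} := by
  have h20 : (2 : F) ≠ 0 := fun h => h2 0 (by simp [h])
  apply Set.Subset.antisymm
  · refine weakComp_subset (by simp) fun u v h => ?_
    have := h2 v
    have := h2 (v / 2)
    rw [eqEdge_X_add_C] at h
    simp only [Set.mem_insert_iff, Set.mem_singleton_iff]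
    clear h2
    grind
  · rintro y (rfl | rfl | rfl)
    · exact mem_weakComp_self _ _
    all_goals
      refine mem_weakComp_of_edge (mem_weakComp_self _ _) (Or.inl ?_)
      rw [eqEdge_X_add_C]
      right
      grind

/-- `G(l, X + a)` has a weakly connected component with exactly three
vertices iff `(l = 2 ∧ a = 1)` or `(l = 1/2 ∧ a = 2)`; in particular, if `2` is a
non-square then `{0, 1, -1}` is a component of `G(2, X + 1)` and `{0, 2, -2}` is a
component of `G(1/2, X + 2)`. -/
theorem stmt14 {F : Type*} [Field F] [Fintype F]
    (hodd : Odd (Fintype.card F))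
    (l : F) (hl : ∀ z : F, z ^ 2 ≠ l) :
    (∀ a : F,
      (∃ x : F, Set.ncard (WeakComp (EqEdge l (X + C a)) x) = 3) ↔
        ((l = 2 ∧ a = 1) ∨ (l = 1 / 2 ∧ a = 2))) ∧
    ((∀ z : F, z ^ 2 ≠ (2 : F)) →
      WeakComp (EqEdge (2 : F) (X + C 1)) 0 = {0, 1, -1} ∧
      WeakComp (EqEdge (1 / 2 : F) (X + C 2)) 0 = {0, 2, -2}) := by
  have h2 : (2 : F) ≠ 0 := by
    refine Ring.two_ne_zero fun hchar => ?_
    have := FiniteField.even_card_of_char_two hchar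
    grind
  refine ⟨fun a => ⟨fun ⟨x, hx⟩ => eq_of_ncard_weakComp_eq_three h2 hl hx, ?_⟩,
    fun hsq => ⟨weakComp_two_X_add_one hsq, weakComp_half_X_add_two hsq⟩⟩
  rintro (⟨rfl, rfl⟩ | ⟨rfl, rfl⟩)
  · refine ⟨0, ?_⟩
    rw [weakComp_two_X_add_one hl]
    exact ncard_zero_self_neg h2 one_ne_zero
  · refine ⟨0, ?_⟩
    rw [weakComp_half_X_add_two fun z hz => hl (z / 2) (by rw [div_pow, hz]; field_simp)]
    exact ncard_zero_self_neg h2 h2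
end

section
/- Let F_q be a finite field of odd order q and let λ ∈ F_q be a non-square element. For any a ∈ F_q with a ≠ 0, the equational graph G(λ, X + a) has no weakly connected component with exactly four vertices. -/
open Polynomial

theorem weakReach_neighbor {V : Type*} {E : V → V → Prop} {x y z : V}
    (hy : y ∈ WeakComp E x) (h : E y z ∨ E z y) : z ∈ WeakComp E x :=
  Relation.ReflTransGen.tail hy h

/-- Splitting four distinct elements of `{u, -u, v, -v}` into two pairs: either both pairs sum
to zero, or the second pair consists of the negatives of the first. -/
theorem pairing_of_mem_neg_pairs {F : Type*} [Field F] {u v p q r s : F}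
    (hp : p = u ∨ p = -u ∨ p = v ∨ p = -v) (hq : q = u ∨ q = -u ∨ q = v ∨ q = -v)
    (hr : r = u ∨ r = -u ∨ r = v ∨ r = -v) (hs : s = u ∨ s = -u ∨ s = v ∨ s = -v)
    (hpq : p ≠ q) (hpr : p ≠ r) (hps : p ≠ s) (hqr : q ≠ r) (hqs : q ≠ s) (hrs : r ≠ s) :
    (p + q = 0 ∧ r + s = 0) ∨ (r = -p ∧ s = -q) ∨ (r = -q ∧ s = -p) := by
  rcases hp with rfl | rfl | rfl | rfl <;> rcases hq with rfl | rfl | rfl | rfl <;>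
    first
    | exact absurd rfl hpq
    | (rcases hr with rfl | rfl | rfl | rfl <;>
        first
        | exact absurd rfl hpr
        | exact absurd rfl hqr
        | (rcases hs with rfl | rfl | rfl | rfl <;>
            first
            | exact absurd rfl hps
            | exact absurd rfl hqs
            | exact absurd rfl hrs
            | simp))

/-- for `a ≠ 0`, `G(l, X + a)` has no weakly connected component with
exactly four vertices. -/
theorem stmt15 {F : Type*} [Field F] [Fintype F]
    (hodd : Odd (Fintype.card F))
    (l : F) (hl : ∀ z : F, z ^ 2 ≠ l)
    (a : F) (ha : a ≠ 0) :
    ¬ ∃ x : F, Set.ncard (WeakComp (EqEdge l (X + C a)) x) = 4 := by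
  rintro ⟨x, hx⟩
  set K := WeakComp (EqEdge l (X + C a)) x
  have two_ne : (2 : F) ≠ 0 := by
    refine Ring.two_ne_zero fun h => ?_
    have := FiniteField.even_card_of_char_two h
    rw [Nat.odd_iff] at hodd
    omega
  have l_ne_one : l ≠ 1 := fun h => hl 1 (by simp [h])
  have sq_mem : ∀ y ∈ K, y ^ 2 - a ∈ K := fun y hy =>
    weakReach_neighbor hy (Or.inr (by simp [EqEdge]))
  have mul_sq_mem : ∀ y ∈ K, l * y ^ 2 - a ∈ K := fun y hy =>
    weakReach_neighbor hy (Or.inr (by simp [EqEdge]))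
  have neg_mem : ∀ y ∈ K, -y ∈ K := fun y hy =>
    weakReach_neighbor (sq_mem y hy) (Or.inl (by simp [EqEdge]))
  obtain ⟨u, hu, hu0⟩ : ∃ u ∈ K, u ∉ ({0} : Set F) :=
    Set.exists_mem_notMem_of_ncard_lt_ncard (by simp [hx])
  obtain ⟨v, hv, hv'⟩ : ∃ v ∈ K, v ∉ ({0, u, -u} : Set F) := by
    refine Set.exists_mem_notMem_of_ncard_lt_ncard ?_
    have h₁ := Set.ncard_insert_le (0 : F) {u, -u}
    have h₂ := Set.ncard_insert_le u {-u}
    rw [Set.ncard_singleton] at h₂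
    omega
  simp only [Set.mem_singleton_iff, Set.mem_insert_iff, not_or] at hu0 hv'
  obtain ⟨hv0, hvu, hvu'⟩ := hv'
  have ne_neg : ∀ y : F, y ≠ 0 → y ≠ -y := fun y hy h => by
    have : 2 * y = 0 := by linear_combination h
    exact hy ((mul_eq_zero.mp this).resolve_left two_ne)
  have hKeq : ({u, -u, v, -v} : Set F) = K := by
    refine Set.eq_of_subset_of_ncard_le ?_ ?_ (Set.toFinite K)
    · rintro y (rfl | rfl | rfl | rfl)
      exacts [hu, neg_mem _ hu, hv, neg_mem _ hv]
    · rw [hx, Set.ncard_insert_of_notMem, Set.ncard_insert_of_notMem,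
        Set.ncard_pair (ne_neg v hv0)]
      · simp only [Set.mem_singleton_iff, Set.mem_insert_iff, not_or]
        exact ⟨fun h => hvu' h.symm, fun h => hvu (neg_injective h).symm⟩
      · simp only [Set.mem_singleton_iff, Set.mem_insert_iff, not_or]
        exact ⟨ne_neg u hu0, fun h => hvu h.symm, fun h => hvu' (by rw [h, neg_neg])⟩
  have mem : ∀ y ∈ K, y = u ∨ y = -u ∨ y = v ∨ y = -v := fun y hy => by
    rw [← hKeq] at hy
    simpa using hy
  have sq_ne : u ^ 2 ≠ v ^ 2 := fun h => by
    rcases sq_eq_sq_iff_eq_or_eq_neg.mp h with h | h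
    exacts [hvu h.symm, hvu' (by rw [h, neg_neg])]
  have ne_mul_sq : ∀ y z : F, z ≠ 0 → y ^ 2 ≠ l * z ^ 2 := fun y z hz h =>
    hl (y / z) (by rw [div_pow, h, mul_div_cancel_right₀ _ (pow_ne_zero 2 hz)])
  have l_ne_zero : l ≠ 0 := fun h => hl 0 (by simp [h])
  have two_a_ne : 2 * a ≠ 0 := mul_ne_zero two_ne ha
  have sub_ne : l - 1 ≠ 0 := sub_ne_zero.mpr l_ne_one
  have sq_sub_ne : u ^ 2 - v ^ 2 ≠ 0 := sub_ne_zero.mpr sq_ne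
  rcases pairing_of_mem_neg_pairs (mem _ (sq_mem u hu)) (mem _ (mul_sq_mem u hu))
      (mem _ (sq_mem v hv)) (mem _ (mul_sq_mem v hv))
      (fun h => ne_mul_sq u u hu0 (sub_left_injective h))
      (fun h => sq_ne (sub_left_injective h))
      (fun h => ne_mul_sq u v hv0 (sub_left_injective h))
      (fun h => ne_mul_sq v u hu0 (sub_left_injective h).symm)
      (fun h => sq_ne (mul_left_cancel₀ l_ne_zero (sub_left_injective h)))
      (fun h => ne_mul_sq v v hv0 (sub_left_injective h)) with ⟨h₁, h₂⟩ | ⟨h₁, h₂⟩ | ⟨h₁, h₂⟩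
  · have h : (1 + l) * (u ^ 2 - v ^ 2) = 0 := by linear_combination h₁ - h₂
    have hl' : 1 + l = 0 := (mul_eq_zero.mp h).resolve_right sq_sub_ne
    exact two_a_ne (by linear_combination u ^ 2 * hl' - h₁)
  · exact mul_ne_zero sub_ne two_a_ne (by linear_combination h₂ - l * h₁)
  · exact mul_ne_zero sub_ne sq_sub_ne (by linear_combination h₁ - h₂)
end
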